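/- For all t > 0, x > 0, y > 0 one has (2/π)·∫₀^∞ ψ₁(λx)·ψ₁(λy)·e^{−λt} dλ = (1/π)·t/(t² + (x−y)²) − (1/(x·y))·∫₀^t f(s/x)·f((t−s)/y)/(s/x + (t−s)/y) ds. (This identity gives the explicit transition density p_t^D(x,y) of the Cauchy process killed on exiting the half-line (0,∞), i.e. the heat kernel of −√(−d²/dx²) with Dirichlet exterior condition on (−∞,0].) -/

import Mathlib

open Real MeasureTheory Set

/-- `η t = (1/4)·log(1+t²) − (1/π)·∫₀^t log|s|/(1+s²) ds`. -/
noncomputable def etaF (t : ℝ) : ℝ :=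
  Real.log (1 + t ^ 2) / 4 - (1 / Real.pi) * ∫ s in (0 : ℝ)..t, Real.log |s| / (1 + s ^ 2)

/-- The remainder term `r`. -/
noncomputable def rfun (x : ℝ) : ℝ :=
  (Real.sqrt 2 / (2 * Real.pi)) *
    ∫ t in Ioi (0 : ℝ), (t / (1 + t ^ 2)) * Real.exp (-etaF t) * Real.exp (-t * x)

/-- The generalized eigenfunction `ψ₁`. -/
noncomputable def psiOne (x : ℝ) : ℝ :=
  if 0 < x then Real.sin (x + Real.pi / 8) - rfun x else 0

/-- The first-exit-time density profile `f(s) = (1/π)·(s/(1+s²))·e^{η(s)}`. -/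
noncomputable def fexit (s : ℝ) : ℝ :=
  (1 / Real.pi) * (s / (1 + s ^ 2)) * Real.exp (etaF s)

/-- Multiplying by the removable-singularity inverse: `σ / sinh σ`. -/
noncomputable def divSinh (s : ℂ) : ℂ := (dslope Complex.sinh 0 s)⁻¹

lemma normSq_sinh (x y : ℝ) :
    Complex.normSq (Complex.sinh (x + y * Complex.I)) = Real.sinh x ^ 2 + Real.sin y ^ 2 := by
  rw [Complex.sinh_add, Complex.sinh_mul_I, Complex.cosh_mul_I]
  rw [← Complex.ofReal_sinh, ← Complex.ofReal_cosh, ← Complex.ofReal_sin, ← Complex.ofReal_cos]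
  have h0 : (Real.sinh x : ℂ) * (Real.cos y : ℂ) + (Real.cosh x : ℂ) * ((Real.sin y : ℂ) * Complex.I)
      = ((Real.sinh x * Real.cos y : ℝ) : ℂ) + ((Real.cosh x * Real.sin y : ℝ) : ℂ) * Complex.I := by
    rw [Complex.ofReal_mul, Complex.ofReal_mul]; ring
  rw [h0, Complex.normSq_add_mul_I]
  have h1 := Real.cosh_sq x
  have h2 := Real.sin_sq_add_cos_sq y
  linear_combination (Real.sin y)^2 * h1 + (Real.sinh x)^2 * h2

lemma dslope_sinh_ne_zero {s : ℂ} (hs : |s.im| < π) : dslope Complex.sinh 0 s ≠ 0 := by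
  rcases eq_or_ne s 0 with rfl | h0
  · simp [dslope_same]
  · rw [dslope_of_ne _ h0, slope_def_field]
    simp only [Complex.sinh_zero, sub_zero]
    refine div_ne_zero (fun h => h0 ?_) h0
    have h1 := normSq_sinh s.re s.im
    rw [Complex.re_add_im, h] at h1
    simp only [map_zero] at h1
    have h2 : Real.sinh s.re = 0 := by nlinarith [sq_nonneg (Real.sinh s.re), sq_nonneg (Real.sin s.im)]
    have h3 : Real.sin s.im = 0 := by nlinarith [sq_nonneg (Real.sinh s.re), sq_nonneg (Real.sin s.im)]
    rw [Real.sinh_eq_zero] at h2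
    rw [abs_lt] at hs
    rw [Real.sin_eq_zero_iff_of_lt_of_lt hs.1 hs.2] at h3
    exact Complex.ext h2 h3

lemma divSinh_differentiableAt {s : ℂ} (hs : |s.im| < π) : DifferentiableAt ℂ divSinh s := by
  have h : DifferentiableOn ℂ (dslope Complex.sinh 0) univ :=
    (Complex.differentiableOn_dslope Filter.univ_mem).2 Complex.differentiable_sinh.differentiableOn
  exact (h.differentiableAt Filter.univ_mem).inv (dslope_sinh_ne_zero hs)

lemma divSinh_mul_sinh {s : ℂ} (hs : |s.im| < π) : divSinh s * Complex.sinh s = s := by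
  have h := dslope_sinh_ne_zero hs
  have h2 : s * dslope Complex.sinh 0 s = Complex.sinh s := by
    have := sub_smul_dslope Complex.sinh 0 s
    simpa using this
  unfold divSinh
  rw [← h2]; field_simp

lemma divSinh_conj (s : ℂ) : divSinh (starRingEnd ℂ s) = starRingEnd ℂ (divSinh s) := by
  unfold divSinh
  rw [map_inv₀]
  congr 1
  rcases eq_or_ne s 0 with rfl | h0
  · simp [dslope_same]
  · have : starRingEnd ℂ s ≠ 0 := by simpa using h0
    rw [dslope_of_ne _ h0, dslope_of_ne _ this, slope_def_field, slope_def_field]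
    simp [Complex.sinh_conj]

lemma norm_divSinh_le {s : ℂ} (hs : |s.im| ≤ π / 2) : ‖divSinh s‖ ≤ π / 2 := by
  have hpi := Real.pi_gt_three
  have hs' : |s.im| < π := by linarith
  rcases eq_or_ne s 0 with rfl | h0
  · simp [divSinh, dslope_same]; linarith
  have h := dslope_sinh_ne_zero hs'
  have hm := divSinh_mul_sinh hs'
  have hsq : ‖s‖ ^ 2 ≤ (π / 2) ^ 2 * ‖Complex.sinh s‖ ^ 2 := by
    rw [← Complex.normSq_eq_norm_sq, ← Complex.normSq_eq_norm_sq]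
    have h1 := normSq_sinh s.re s.im
    rw [Complex.re_add_im] at h1
    rw [h1, Complex.normSq_apply]
    have h2 : s.re ^ 2 ≤ Real.sinh s.re ^ 2 := by
      rw [sq_le_sq, Real.abs_sinh]
      exact Real.self_le_sinh_iff.2 (abs_nonneg _)
    have h3 : (2 / π * |s.im|) ≤ |Real.sin s.im| := Real.mul_abs_le_abs_sin hs
    have h4 : s.im ^ 2 ≤ (π / 2) ^ 2 * Real.sin s.im ^ 2 := by
      rw [← sq_abs s.im, ← sq_abs (Real.sin s.im), ← mul_pow]
      apply pow_le_pow_left₀ (abs_nonneg _)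
      rw [div_mul_eq_mul_div, div_le_iff₀ (by positivity)] at h3
      linarith
    have h5 : (1 : ℝ) ≤ (π / 2) ^ 2 := by nlinarith
    nlinarith [sq_nonneg (Real.sinh s.re)]
  have h6 : ‖s‖ ≤ π / 2 * ‖Complex.sinh s‖ := by
    rw [← mul_pow] at hsq
    exact le_of_sq_le_sq hsq (by positivity)
  have h7 : Complex.sinh s ≠ 0 := by
    intro h; rw [h, mul_zero] at hm; exact h0 hm.symm
  have h8 : ‖divSinh s‖ * ‖Complex.sinh s‖ ≤ π / 2 * ‖Complex.sinh s‖ := by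
    rw [← norm_mul, hm]; exact h6
  exact le_of_mul_le_mul_right h8 (norm_pos_iff.2 h7)

lemma exists_primitive_divSinh_conj : ∃ T : ℂ → ℂ, T 0 = 0 ∧
    (∀ s, |s.im| < π → HasDerivAt T (divSinh s) s) ∧
    ∀ s, T (starRingEnd ℂ s) = starRingEnd ℂ (T s) := by
  suffices h : ∃ T : ℂ → ℂ, ∀ s, |s.im| < π → HasDerivAt T (divSinh s) s by
    obtain ⟨T, hT⟩ := h
    refine ⟨fun s => ((T s - T 0) + starRingEnd ℂ (T (starRingEnd ℂ s) - T 0)) / 2, by simp,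
      fun s hs => ?_, fun s => by simp [add_comm, map_ofNat]⟩
    have h1 := hT (starRingEnd ℂ s) (by simpa using hs)
    have h2 := h1.conj_conj
    rw [Complex.conj_conj] at h2
    have := (((hT s hs).sub_const (T 0)).add (h2.sub_const (starRingEnd ℂ (T 0)))).div_const 2
    have hfun : (fun s => ((T s - T 0) + starRingEnd ℂ (T (starRingEnd ℂ s) - T 0)) / 2) = fun x =>
        ((fun x => T x - T 0) + fun x => (starRingEnd ℂ ∘ T ∘ starRingEnd ℂ) x -
          (starRingEnd ℂ) (T 0)) x / 2 := by
      funext z; simp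
    rw [hfun]
    refine this.congr_deriv ?_
    rw [divSinh_conj]; simp
  let G : ℂ → ℂ := fun w => divSinh (2 * Complex.log ((1 + w) / (1 - w))) * (4 / (1 - w ^ 2))
  have hre : ∀ w : ℂ, ‖w‖ < 1 → 0 < ((1 + w) / (1 - w)).re := by
    intro w hw
    have h1 : (1 - w) ≠ 0 := by
      intro h; rw [sub_eq_zero] at h; rw [← h] at hw; simp at hw
    rw [Complex.div_re, ← add_div]
    apply div_pos _ (Complex.normSq_pos.2 h1)
    have : w.re ^ 2 + w.im ^ 2 < 1 := by
      have := Complex.sq_norm w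
      rw [Complex.normSq_apply] at this
      nlinarith [norm_nonneg w]
    simp; nlinarith
  have hG : DifferentiableOn ℂ G (Metric.ball 0 1) := by
    intro w hw
    have hw : ‖w‖ < 1 := by simpa using hw
    have h1 : (1 - w) ≠ 0 := by
      intro h; rw [sub_eq_zero] at h; rw [← h] at hw; simp at hw
    have h1' : (1 + w) ≠ 0 := by
      intro h
      have := hre w hw
      simp [h] at this
    have h2 : (1 - w ^ 2) ≠ 0 := by
      have : 1 - w ^ 2 = (1 - w) * (1 + w) := by ring
      rw [this]; exact mul_ne_zero h1 h1'
    have h3 := hre w hw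
    have harg : |(2 * Complex.log ((1 + w) / (1 - w))).im| < π := by
      have h4 := Complex.abs_arg_lt_pi_div_two_iff.2 (Or.inl h3)
      have : (2 * Complex.log ((1 + w) / (1 - w))).im = 2 * Complex.arg ((1 + w) / (1 - w)) := by
        simp [Complex.mul_im, Complex.log_im]
      rw [this, abs_mul, abs_two]; linarith
    apply DifferentiableAt.differentiableWithinAt
    apply DifferentiableAt.mul
    · apply DifferentiableAt.comp (g := divSinh) w (divSinh_differentiableAt harg)
      apply DifferentiableAt.const_mul
      refine DifferentiableAt.clog (f := fun y => (1 + y) / (1 - y)) ?_ (Or.inl h3)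
      exact DifferentiableAt.div (by fun_prop) (by fun_prop) h1
    · exact DifferentiableAt.div (by fun_prop) (by fun_prop) h2
  obtain ⟨Φ, hΦ⟩ := hG.isExactOn_ball
  refine ⟨fun s => Φ ((Complex.exp (s / 2) - 1) / (Complex.exp (s / 2) + 1)), fun s hs => ?_⟩
  set e := Complex.exp (s / 2) with he
  have him : |(s / 2).im| < π / 2 := by
    have : (s / 2).im = s.im / 2 := by simp
    rw [this, abs_div, abs_two]; linarith
  have here : 0 < e.re := by
    rw [he, Complex.exp_re]
    have := abs_lt.1 him
    exact mul_pos (Real.exp_pos _) (Real.cos_pos_of_mem_Ioo ⟨this.1, this.2⟩)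
  have hne : e + 1 ≠ 0 := by
    intro h; have := congrArg Complex.re h; simp at this; linarith
  have he0 : e ≠ 0 := Complex.exp_ne_zero _
  have hball : ‖(e - 1) / (e + 1)‖ < 1 := by
    rw [norm_div, div_lt_one (norm_pos_iff.2 hne)]
    apply lt_of_pow_lt_pow_left₀ 2 (norm_nonneg _)
    rw [Complex.sq_norm, Complex.sq_norm, Complex.normSq_apply, Complex.normSq_apply]
    simp; nlinarith
  have hd := hΦ ((e - 1) / (e + 1)) (by simpa using hball)
  have hw : HasDerivAt (fun s : ℂ => (Complex.exp (s / 2) - 1) / (Complex.exp (s / 2) + 1))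
      (((e * (1 / 2)) * (e + 1) - (e - 1) * (e * (1 / 2))) / (e + 1) ^ 2) s := by
    have h1 : HasDerivAt (fun s : ℂ => Complex.exp (s / 2)) (e * (1 / 2)) s :=
      ((hasDerivAt_id s).div_const 2).cexp
    exact (h1.sub_const 1).div (h1.add_const 1) hne
  have := HasDerivAt.comp s hd hw
  refine this.congr_deriv ?_
  have h5 : (1 + (e - 1) / (e + 1)) / (1 - (e - 1) / (e + 1)) = e := by
    have : (1 - (e - 1) / (e + 1)) = 2 / (e + 1) := by field_simp; ring
    rw [this]; field_simp; ring
  have h6 : Complex.log e = s / 2 := by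
    rw [he, Complex.log_exp] <;> linarith [abs_lt.1 him, Real.pi_pos, (abs_lt.1 him).1, (abs_lt.1 him).2]
  change divSinh (2 * Complex.log ((1 + (e - 1) / (e + 1)) / (1 - (e - 1) / (e + 1)))) *
    (4 / (1 - ((e - 1) / (e + 1)) ^ 2)) * _ = divSinh s
  rw [h5, h6]
  have h7 : 2 * (s / 2) = s := by ring
  have h8 : 1 - ((e - 1) / (e + 1)) ^ 2 = 4 * e / (e + 1) ^ 2 := by field_simp; ring
  rw [h7, h8]
  field_simp
  ring

lemma divSinh_neg (s : ℂ) : divSinh (-s) = divSinh s := by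
  unfold divSinh
  congr 1
  rcases eq_or_ne s 0 with rfl | h0
  · simp
  · rw [dslope_of_ne _ h0, dslope_of_ne _ (neg_ne_zero.2 h0), slope_def_field, slope_def_field]
    simp [Complex.sinh_neg, neg_div_neg_eq]

lemma exists_primitive_divSinh : ∃ T : ℂ → ℂ, T 0 = 0 ∧
    (∀ s, |s.im| < π → HasDerivAt T (divSinh s) s) ∧
    (∀ s, T (starRingEnd ℂ s) = starRingEnd ℂ (T s)) ∧ ∀ s, T (-s) = -T s := by
  obtain ⟨T, -, hT, hc⟩ := exists_primitive_divSinh_conj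
  refine ⟨fun s => (T s - T (-s)) / 2, by simp, fun s hs => ?_, fun s => ?_, fun s => ?_⟩
  · have h1 := (hT (-s) (by simpa using hs)).comp s (hasDerivAt_neg s)
    refine (((hT s hs).sub h1).div_const 2).congr_deriv ?_
    rw [divSinh_neg]; ring
  · simp only [← map_neg, hc, map_div₀, map_sub, map_ofNat]
  · simp only [neg_neg]; ring

lemma intervalIntegrable_log_div (a b : ℝ) :
    IntervalIntegrable (fun s : ℝ => Real.log |s| / (1 + s ^ 2)) volume a b := by
  have h : IntervalIntegrable Real.log volume a b := intervalIntegral.intervalIntegrable_log'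
  have h2 : ContinuousOn (fun s : ℝ => (1 + s ^ 2)⁻¹) (uIcc a b) :=
    ContinuousOn.inv₀ (by fun_prop) (fun x _ => by positivity)
  have := h.mul_continuousOn h2
  simpa [Real.log_abs, div_eq_mul_inv] using this

lemma etaF_zero : etaF 0 = 0 := by simp [etaF]

lemma continuous_etaF : Continuous etaF := by
  unfold etaF
  apply Continuous.sub
  · apply Continuous.div_const
    exact Continuous.log (by fun_prop) (fun x => by positivity)
  · apply Continuous.mul continuous_const
    exact intervalIntegral.continuous_primitive intervalIntegrable_log_div 0

lemma hasDerivAt_etaF {u : ℝ} (hu : 0 < u) :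
    HasDerivAt etaF (u / (2 * (1 + u ^ 2)) - Real.log u / (π * (1 + u ^ 2))) u := by
  have h1 : HasDerivAt (fun t : ℝ => Real.log (1 + t ^ 2) / 4) ((2 * u) / (1 + u ^ 2) / 4) u := by
    have : HasDerivAt (fun t : ℝ => 1 + t ^ 2) (2 * u) u := by
      simpa using (hasDerivAt_pow 2 u).const_add 1
    exact (this.log (by positivity)).div_const 4
  have hc : ContinuousAt (fun s : ℝ => Real.log |s| / (1 + s ^ 2)) u := by
    apply ContinuousAt.div _ (by fun_prop) (by positivity)
    exact ContinuousAt.log (by fun_prop) (by simpa using hu.ne')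
  have hm : StronglyMeasurableAtFilter (fun s : ℝ => Real.log |s| / (1 + s ^ 2)) (nhds u) :=
    (Measurable.stronglyMeasurable (by fun_prop)).stronglyMeasurableAtFilter
  have h2 := intervalIntegral.integral_hasDerivAt_right (intervalIntegrable_log_div 0 u) hm hc
  have h3 := h1.sub (h2.const_mul (1 / π))
  refine h3.congr_deriv ?_
  rw [abs_of_pos hu]
  field_simp
  ring

lemma norm_one_add_cexp_le (s : ℂ) : ‖1 + Complex.exp s‖ ≤ 1 + Real.exp s.re := by
  refine (norm_add_le _ _).trans ?_
  rw [Complex.norm_exp]; simp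

lemma le_norm_one_add_cexp {s : ℂ} (hs : |s.im| ≤ π / 2) :
    (1 + Real.exp s.re) / 2 ≤ ‖1 + Complex.exp s‖ := by
  have hc : 0 ≤ Real.cos s.im := Real.cos_nonneg_of_mem_Icc ⟨(abs_le.1 hs).1, (abs_le.1 hs).2⟩
  have he := Real.exp_pos s.re
  have h1 : (1 + Real.exp s.re) / 2 ≤ √(1 + Real.exp s.re ^ 2) := by
    apply Real.le_sqrt_of_sq_le
    nlinarith [sq_nonneg (1 - Real.exp s.re)]
  refine h1.trans ?_
  apply Real.sqrt_le_iff.2 ⟨norm_nonneg _, ?_⟩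
  rw [Complex.sq_norm, Complex.normSq_apply]
  simp only [Complex.add_re, Complex.one_re, Complex.exp_re, Complex.add_im, Complex.one_im,
    Complex.exp_im]
  have := Real.sin_sq_add_cos_sq s.im
  have h2 : 0 ≤ Real.exp s.re * Real.cos s.im := by positivity
  have h3 : Real.exp s.re ^ 2 * (Real.sin s.im ^ 2 + Real.cos s.im ^ 2) = Real.exp s.re ^ 2 := by
    rw [this, mul_one]
  nlinarith

lemma one_add_cexp_mem_slitPlane {s : ℂ} (hs : |s.im| < π) :
    1 + Complex.exp s ∈ Complex.slitPlane := by
  rw [Complex.mem_slitPlane_iff]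
  rcases eq_or_ne s.im 0 with h | h
  · left
    simp [Complex.exp_re, h]; positivity
  · right
    simp only [Complex.add_im, Complex.one_im, Complex.exp_im, zero_add]
    apply mul_ne_zero (Real.exp_pos _).ne'
    rw [abs_lt] at hs
    rw [Ne, Real.sin_eq_zero_iff_of_lt_of_lt hs.1 hs.2]
    exact h

lemma norm_divSinh_le_of_re {s : ℂ} (hs : |s.im| ≤ π / 2) (hr : s.re ≠ 0) :
    ‖divSinh s‖ ≤ 4 * (|s.re| + π / 2) / s.re ^ 2 := by
  have hpi := Real.pi_pos
  have hm := divSinh_mul_sinh (s := s) (by linarith)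
  have h1 : ‖s‖ ≤ |s.re| + π / 2 := (Complex.norm_le_abs_re_add_abs_im s).trans (by linarith)
  have h2 : s.re ^ 2 / 4 ≤ ‖Complex.sinh s‖ := by
    have h3 : |Real.sinh s.re| ≤ ‖Complex.sinh s‖ := by
      apply abs_le_of_sq_le_sq' _ (norm_nonneg _) |> abs_le.2
      rw [Complex.sq_norm, ← Complex.re_add_im s, normSq_sinh]
      simp
      positivity
    refine le_trans ?_ h3
    rw [Real.abs_sinh, Real.sinh_eq]
    have h4 := Real.quadratic_le_exp_of_nonneg (abs_nonneg s.re)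
    have h5 : Real.exp (-|s.re|) ≤ 1 := Real.exp_le_one_iff.2 (by simp)
    have h6 := abs_nonneg s.re
    rw [sq_abs] at h4
    linarith
  rw [le_div_iff₀ (by positivity)]
  have h7 : ‖divSinh s‖ * ‖Complex.sinh s‖ = ‖s‖ := by rw [← norm_mul, hm]
  nlinarith [norm_nonneg (divSinh s)]

lemma norm_sub_le_of_primitive {T : ℂ → ℂ} (hT : ∀ s, |s.im| < π → HasDerivAt T (divSinh s) s)
    {s : ℂ} (hs : |s.im| ≤ π / 2) {C : ℝ}
    (hC : ∀ w : ℂ, |w.im| ≤ π / 2 → w.re = s.re → ‖divSinh w‖ ≤ C) :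
    ‖T s - T s.re‖ ≤ C * (π / 2) := by
  have hpi := Real.pi_pos
  have hconv : Convex ℝ {w : ℂ | |w.im| ≤ π / 2 ∧ w.re = s.re} := by
    have h1 : {w : ℂ | |w.im| ≤ π / 2 ∧ w.re = s.re} =
      (Complex.imLm ⁻¹' (Icc (-(π / 2)) (π / 2))) ∩ (Complex.reLm ⁻¹' {s.re}) := by
      ext w; simp [abs_le]
    rw [h1]
    exact ((convex_Icc _ _).linear_preimage _).inter ((convex_singleton _).linear_preimage _)
  have := Convex.norm_image_sub_le_of_norm_hasDerivWithin_le (f := T) (f' := divSinh) (C := C)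
    (s := {w : ℂ | |w.im| ≤ π / 2 ∧ w.re = s.re}) (x := (s.re : ℂ)) (y := s)
    (fun w hw => (hT w (by linarith [hw.1])).hasDerivWithinAt) (fun w hw => hC w hw.1 hw.2) hconv
    (by simp; positivity) ⟨hs, rfl⟩
  refine this.trans ?_
  have h0 : 0 ≤ C := (norm_nonneg _).trans (hC s hs rfl)
  apply mul_le_mul_of_nonneg_left _ h0
  have : s - s.re = s.im * Complex.I := by
    nth_rewrite 1 [← Complex.re_add_im s]; ring
  rw [this]; simpa using hs

/-- The logarithm of the Wiener–Hopf factor in the upper half-plane, in the coordinate `z = i e^σ`,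
built from a primitive `T` of `σ / sinh σ`. -/
noncomputable def logFactor (T : ℂ → ℂ) (s : ℂ) : ℂ :=
  Complex.log (1 + Complex.exp s) / 2 + π / 8 * Complex.I + Complex.I * T s / (2 * π)

lemma hasDerivAt_logFactor {T : ℂ → ℂ} (hT : ∀ s, |s.im| < π → HasDerivAt T (divSinh s) s)
    {s : ℂ} (hs : |s.im| < π) :
    HasDerivAt (logFactor T)
      (Complex.exp s / (1 + Complex.exp s) / 2 + Complex.I * divSinh s / (2 * π)) s := by
  have h1 := ((Complex.hasDerivAt_exp s).const_add 1).clog (one_add_cexp_mem_slitPlane hs)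
  exact ((h1.div_const 2).add_const _).add (((hT s hs).const_mul Complex.I).div_const _)

lemma cexp_sub_pi_div_two (x : ℝ) :
    Complex.exp (x - π / 2 * Complex.I) = -(Real.exp x * Complex.I) := by
  rw [Complex.exp_sub, Complex.exp_pi_div_two_mul_I, ← Complex.ofReal_exp]
  field_simp; simp

lemma cexp_add_pi_div_two (x : ℝ) :
    Complex.exp (x + π / 2 * Complex.I) = Real.exp x * Complex.I := by
  rw [Complex.exp_add, Complex.exp_pi_div_two_mul_I, ← Complex.ofReal_exp]

lemma im_sub_pi_div_two (x : ℝ) : ((x : ℂ) - π / 2 * Complex.I).im = -(π / 2) := by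
  simp

lemma im_add_pi_div_two (x : ℝ) : ((x : ℂ) + π / 2 * Complex.I).im = π / 2 := by
  simp

lemma re_sub_pi_div_two (x : ℝ) : ((x : ℂ) - π / 2 * Complex.I).re = x := by
  simp

lemma re_add_pi_div_two (x : ℝ) : ((x : ℂ) + π / 2 * Complex.I).re = x := by
  simp

lemma divSinh_sub_pi_div_two (x : ℝ) :
    divSinh (x - π / 2 * Complex.I) =
      Complex.I * (x - π / 2 * Complex.I) * (2 * Real.exp x / (1 + Real.exp x ^ 2)) := by
  have hpi := Real.pi_pos
  have hm := divSinh_mul_sinh (s := x - π / 2 * Complex.I)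
    (by rw [im_sub_pi_div_two, abs_neg, abs_of_pos] <;> linarith)
  have he : (Real.exp x : ℂ) ≠ 0 := by exact_mod_cast (Real.exp_pos x).ne'
  have he2 : (1 + (Real.exp x : ℂ) ^ 2) ≠ 0 := by
    exact_mod_cast (by positivity : (1 + Real.exp x ^ 2) ≠ 0)
  have hs : Complex.sinh (x - π / 2 * Complex.I) =
      -Complex.I * (1 + Real.exp x ^ 2) / (2 * Real.exp x) := by
    rw [Complex.sinh, Complex.exp_neg, cexp_sub_pi_div_two]
    field_simp
    rw [Complex.I_sq]; ring_nf
  rw [hs] at hm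
  have h : divSinh (x - π / 2 * Complex.I) = (x - π / 2 * Complex.I) /
      (-Complex.I * (1 + Real.exp x ^ 2) / (2 * Real.exp x)) := by
    rw [eq_div_iff, hm]
    exact div_ne_zero (mul_ne_zero (neg_ne_zero.2 Complex.I_ne_zero) he2)
      (mul_ne_zero two_ne_zero he)
  rw [h]
  field_simp
  rw [Complex.I_sq]; ring

lemma logFactor_sub_pi_div_two_deriv {T : ℂ → ℂ}
    (hT : ∀ s, |s.im| < π → HasDerivAt T (divSinh s) s) (x : ℝ) :
    HasDerivAt (fun x : ℝ => logFactor T (x - π / 2 * Complex.I) - etaF (Real.exp x)) 0 x := by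
  have hpi := Real.pi_pos
  have him : |((x : ℂ) - π / 2 * Complex.I).im| < π := by
    rw [im_sub_pi_div_two, abs_neg, abs_of_pos] <;> linarith
  have h1 := (hasDerivAt_logFactor hT him).comp (x : ℂ) ((hasDerivAt_id (x : ℂ)).sub_const _)
  have h2 := h1.comp_ofReal
  have h3 := ((hasDerivAt_etaF (Real.exp_pos x)).comp x (Real.hasDerivAt_exp x)).ofReal_comp
  refine (h2.sub h3).congr_deriv ?_
  rw [cexp_sub_pi_div_two, divSinh_sub_pi_div_two, Real.log_exp]
  have hp : (π : ℂ) ≠ 0 := by exact_mod_cast hpi.ne'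
  have he2 : (1 + (Real.exp x : ℂ) ^ 2) ≠ 0 := by
    exact_mod_cast (by positivity : (1 + Real.exp x ^ 2) ≠ 0)
  have he3 : 1 + -((Real.exp x : ℂ) * Complex.I) ≠ 0 := by
    intro h; have := congrArg Complex.re h; simp at this
  have he4 : -((Real.exp x : ℂ) * Complex.I) / (1 + -((Real.exp x : ℂ) * Complex.I)) =
      (Real.exp x ^ 2 - Real.exp x * Complex.I) / (1 + (Real.exp x : ℂ) ^ 2) := by
    rw [div_eq_div_iff he3 he2]
    ring_nf
    simp only [Complex.I_sq]; ring
  rw [he4]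
  push_cast
  simp only [← Complex.ofReal_exp]
  field_simp
  ring_nf
  simp only [Complex.I_sq, Complex.I_pow_three]
  ring

lemma tendsto_norm_bound :
    Filter.Tendsto (fun x : ℝ => 4 * (|x| + π / 2) / x ^ 2) Filter.atBot (nhds 0) := by
  have h1 : Filter.Tendsto (fun x : ℝ => x⁻¹) Filter.atBot (nhds 0) := tendsto_inv_atBot_zero
  have h2 : Filter.Tendsto (fun x : ℝ => 4 * (-x⁻¹ + π / 2 * (x⁻¹) ^ 2)) Filter.atBot
      (nhds (4 * (-0 + π / 2 * 0 ^ 2))) := (h1.neg.add ((h1.pow 2).const_mul _)).const_mul 4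
  simp only [neg_zero, ne_eq, OfNat.ofNat_ne_zero, not_false_eq_true, zero_pow, mul_zero,
    add_zero] at h2
  refine h2.congr' ?_
  filter_upwards [Filter.eventually_lt_atBot 0] with x hx
  rw [abs_of_neg hx]
  field_simp

lemma im_ofReal_primitive {T : ℂ → ℂ} (hc : ∀ s, T (starRingEnd ℂ s) = starRingEnd ℂ (T s))
    (x : ℝ) : (T x).im = 0 := by
  have := hc x
  rw [Complex.conj_ofReal] at this
  exact Complex.conj_eq_iff_im.1 this.symm

lemma logFactor_sub_pi_div_two {T : ℂ → ℂ}
    (hT : ∀ s, |s.im| < π → HasDerivAt T (divSinh s) s)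
    (hc : ∀ s, T (starRingEnd ℂ s) = starRingEnd ℂ (T s)) (hn : ∀ s, T (-s) = -T s) (x : ℝ) :
    logFactor T (x - π / 2 * Complex.I) = etaF (Real.exp x) := by
  have hpi := Real.pi_pos
  have hconst : ∀ x : ℝ, logFactor T (x - π / 2 * Complex.I) - etaF (Real.exp x) =
      logFactor T ((0 : ℝ) - π / 2 * Complex.I) - etaF (Real.exp 0) := fun x =>
    is_const_of_deriv_eq_zero (fun y => (logFactor_sub_pi_div_two_deriv hT y).differentiableAt)
      (fun y => (logFactor_sub_pi_div_two_deriv hT y).deriv) x 0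
  set c := logFactor T ((0 : ℝ) - π / 2 * Complex.I) - etaF (Real.exp 0) with hcdef
  have him : c.im = 0 := by
    rw [hcdef]
    have h1 : starRingEnd ℂ (T ((0 : ℝ) - π / 2 * Complex.I)) = -T ((0 : ℝ) - π / 2 * Complex.I) := by
      rw [← hc, ← hn]; congr 1; simp [map_ofNat]
    have h2 : (T ((0 : ℝ) - π / 2 * Complex.I)).re = 0 := by
      have := congrArg Complex.re h1
      simp only [Complex.conj_re, Complex.neg_re] at this
      linarith
    have h3 : (Complex.log (1 + -Complex.I)).im = -(π / 4) := by
      rw [Complex.log_im]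
      have h4 : (1 + -Complex.I) = (√2 : ℝ) * (Real.cos (-(π / 4)) + Real.sin (-(π / 4)) * Complex.I) := by
        rw [Real.cos_neg, Real.sin_neg, Real.cos_pi_div_four, Real.sin_pi_div_four]
        have : ((√2 : ℝ) : ℂ) * ((√2 : ℝ) : ℂ) = 2 := by
          rw [← Complex.ofReal_mul]; simp
        push_cast at this ⊢
        linear_combination ((-1 + Complex.I) / 2) * this
      rw [h4, Complex.ofReal_cos, Complex.ofReal_sin, Complex.arg_mul_cos_add_sin_mul_I (by positivity)]
      constructor <;> linarith
    have h5 : (logFactor T ((0 : ℝ) - π / 2 * Complex.I)).im = -(π / 4) / 2 + π / 8 +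
        (T ((0 : ℝ) - π / 2 * Complex.I)).re / (2 * π) := by
      unfold logFactor
      rw [cexp_sub_pi_div_two, Real.exp_zero, Complex.ofReal_one, one_mul]
      have : Complex.I * T ((0 : ℝ) - π / 2 * Complex.I) / (2 * π) =
        Complex.I * T ((0 : ℝ) - π / 2 * Complex.I) / ((2 * π : ℝ) : ℂ) := by push_cast; rfl
      rw [this, Complex.add_im, Complex.add_im, Complex.div_ofReal_im, Complex.I_mul_im]
      have h8 : Complex.log (1 + -Complex.I) / 2 = Complex.log (1 + -Complex.I) / ((2 : ℝ) : ℂ) := by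
        push_cast; rfl
      have h9 : ((π : ℂ) / 8 * Complex.I).im = π / 8 := by
        have : (π : ℂ) / 8 = ((π / 8 : ℝ) : ℂ) := by push_cast; rfl
        rw [this, Complex.im_ofReal_mul]; simp
      rw [h8, Complex.div_ofReal_im, h3, h9]
    rw [Complex.sub_im, h5, h2, Complex.ofReal_im]
    ring
  have hre : c.re = 0 := by
    have hform : ∀ x : ℝ, c.re = Real.log ‖1 + Complex.exp (x - π / 2 * Complex.I)‖ / 2 -
        (T (x - π / 2 * Complex.I) - T x).im / (2 * π) - etaF (Real.exp x) := by
      intro x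
      rw [← hconst x, Complex.sub_re, Complex.ofReal_re]
      unfold logFactor
      have h7 : Complex.I * T (x - π / 2 * Complex.I) / (2 * π) =
        Complex.I * T (x - π / 2 * Complex.I) / ((2 * π : ℝ) : ℂ) := by push_cast; rfl
      have h8 : Complex.log (1 + Complex.exp (x - π / 2 * Complex.I)) / 2 =
        Complex.log (1 + Complex.exp (x - π / 2 * Complex.I)) / ((2 : ℝ) : ℂ) := by
        push_cast; rfl
      have h9 : ((π : ℂ) / 8 * Complex.I).re = 0 := by
        have : (π : ℂ) / 8 = ((π / 8 : ℝ) : ℂ) := by push_cast; rfl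
        rw [this, Complex.re_ofReal_mul]; simp
      rw [h7, h8, Complex.add_re, Complex.add_re, Complex.div_ofReal_re, Complex.div_ofReal_re,
        Complex.I_mul_re, h9, Complex.log_re, Complex.sub_im, im_ofReal_primitive hc]
      ring
    have hlim : Filter.Tendsto (fun x : ℝ =>
        Real.log ‖1 + Complex.exp (x - π / 2 * Complex.I)‖ / 2 -
        (T (x - π / 2 * Complex.I) - T x).im / (2 * π) - etaF (Real.exp x)) Filter.atBot
        (nhds (Real.log ‖1 + -(((0 : ℝ) : ℂ) * Complex.I)‖ / 2 - 0 / (2 * π) - etaF 0)) := by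
      have hexp := Real.tendsto_exp_atBot
      refine Filter.Tendsto.sub (Filter.Tendsto.sub ?_ ?_) ?_
      · simp_rw [cexp_sub_pi_div_two]
        apply Filter.Tendsto.div_const
        apply Filter.Tendsto.log _ (by simp)
        apply Filter.Tendsto.norm
        apply Filter.Tendsto.const_add
        apply Filter.Tendsto.neg
        apply Filter.Tendsto.mul_const
        exact (Complex.continuous_ofReal.tendsto 0).comp hexp
      · apply Filter.Tendsto.div_const
        apply squeeze_zero_norm' _ (by simpa using tendsto_norm_bound.mul_const (π / 2))
        filter_upwards [Filter.eventually_lt_atBot 0] with x hx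
        refine (Complex.abs_im_le_norm _).trans ?_
        have := norm_sub_le_of_primitive hT (s := x - π / 2 * Complex.I)
          (C := 4 * (|x| + π / 2) / x ^ 2)
          (by rw [im_sub_pi_div_two, abs_neg, abs_of_pos (by positivity)]) ?_
        · rwa [re_sub_pi_div_two] at this
        · intro w hw hwr
          rw [re_sub_pi_div_two] at hwr
          rw [← hwr]
          exact norm_divSinh_le_of_re hw (by rw [hwr]; exact hx.ne)
      · exact (continuous_etaF.tendsto 0).comp hexp
    have h3 := tendsto_nhds_unique (hlim.congr (fun x => (hform x).symm)) tendsto_const_nhds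
    rw [← h3]
    simp [etaF_zero]
  have : c = 0 := Complex.ext hre him
  have h4 := hconst x
  rw [this, sub_eq_zero] at h4
  exact h4

lemma exists_wienerHopf_factor : ∃ K : ℂ → ℂ,
    (∀ s, |s.im| < π → DifferentiableAt ℂ K s) ∧ (∀ s, K s ≠ 0) ∧
    (∀ x : ℝ, K (x - π / 2 * Complex.I) = Real.exp (etaF (Real.exp x))) ∧
    (∀ x : ℝ, K (x + π / 2 * Complex.I) =
      (1 + Real.exp x * Complex.I) / Real.exp (etaF (Real.exp x))) ∧
    K 0 = √2 * (Real.cos (π / 8) + Real.sin (π / 8) * Complex.I) ∧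
    ∃ c C : ℝ, 0 < c ∧ 0 < C ∧ ∀ s : ℂ, |s.im| ≤ π / 2 →
      c * √(1 + Real.exp s.re) ≤ ‖K s‖ ∧ ‖K s‖ ≤ C * √(1 + Real.exp s.re) := by
  have hpi := Real.pi_pos
  obtain ⟨T, h0, hT, hc, hn⟩ := exists_primitive_divSinh
  have hbot := logFactor_sub_pi_div_two hT hc hn
  refine ⟨fun s => Complex.exp (logFactor T s), fun s hs =>
    (hasDerivAt_logFactor hT hs).differentiableAt.cexp, fun s => Complex.exp_ne_zero _,
    fun x => by simp only [hbot, Complex.ofReal_exp], fun x => ?_, ?_, ?_⟩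
  · rw [eq_div_iff (by exact_mod_cast (Real.exp_pos _).ne'), Complex.ofReal_exp (etaF _),
      ← Complex.conj_ofReal (etaF _), ← hbot, ← Complex.exp_add]
    have hne : 1 + (Real.exp x : ℂ) * Complex.I ≠ 0 := by
      intro h; have := congrArg Complex.re h; simp at this
    have h1 : logFactor T (x + π / 2 * Complex.I) +
        starRingEnd ℂ (logFactor T (x - π / 2 * Complex.I)) =
        Complex.log (1 + Real.exp x * Complex.I) := by
      unfold logFactor
      have e1 : (x : ℂ) + π / 2 * Complex.I = starRingEnd ℂ (x - π / 2 * Complex.I) := by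
        simp [map_ofNat]
      have e2 : starRingEnd ℂ (Complex.log (1 + -(Real.exp x * Complex.I))) =
          Complex.log (1 + Real.exp x * Complex.I) := by
        rw [← Complex.log_conj]
        · simp only [map_add, map_one, map_neg, map_mul, Complex.conj_ofReal, Complex.conj_I]
          ring_nf
        · intro h
          rw [Complex.arg_eq_pi_iff] at h
          have := h.1
          simp at this
          linarith
      rw [cexp_add_pi_div_two, cexp_sub_pi_div_two, e1, hc]
      simp only [map_add, map_div₀, map_mul, e2, map_ofNat, Complex.conj_I, Complex.conj_ofReal]
      ring
    rw [h1, Complex.exp_log hne]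
  · have h1 : logFactor T 0 = ((Real.log 2 / 2 : ℝ) : ℂ) + ((π / 8 : ℝ) : ℂ) * Complex.I := by
      unfold logFactor
      rw [h0, Complex.exp_zero]
      have : (1 : ℂ) + 1 = ((2 : ℝ) : ℂ) := by push_cast; norm_num
      rw [this, ← Complex.ofReal_log (by norm_num)]
      push_cast; ring
    simp only [h1]
    rw [Complex.exp_add, Complex.exp_mul_I, ← Complex.ofReal_exp, ← Complex.ofReal_cos,
      ← Complex.ofReal_sin]
    congr 2
    rw [Real.sqrt_eq_rpow, Real.rpow_def_of_pos (by norm_num)]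
    congr 1; ring
  · refine ⟨√(1 / 2) * Real.exp (-(π / 8)), Real.exp (π / 8), by positivity, by positivity,
      fun s hs => ?_⟩
    have hTim : |(T s).im| ≤ π / 2 * (π / 2) := by
      have h1 := norm_sub_le_of_primitive hT hs (C := π / 2) (fun w hw _ => norm_divSinh_le hw)
      have h2 := (Complex.abs_im_le_norm _).trans h1
      rwa [Complex.sub_im, im_ofReal_primitive hc, sub_zero] at h2
    have hpos : 0 < ‖1 + Complex.exp s‖ := by
      refine lt_of_lt_of_le ?_ (le_norm_one_add_cexp hs)
      positivity
    have hnorm : ‖Complex.exp (logFactor T s)‖ =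
        √‖1 + Complex.exp s‖ * Real.exp (-(T s).im / (2 * π)) := by
      rw [Complex.norm_exp, Real.sqrt_eq_rpow, Real.rpow_def_of_pos hpos, ← Real.exp_add]
      congr 1
      unfold logFactor
      have h7 : Complex.I * T s / (2 * π) = Complex.I * T s / ((2 * π : ℝ) : ℂ) := by
        push_cast; rfl
      have h8 : Complex.log (1 + Complex.exp s) / 2 =
        Complex.log (1 + Complex.exp s) / ((2 : ℝ) : ℂ) := by
        push_cast; rfl
      have h9 : ((π : ℂ) / 8 * Complex.I).re = 0 := by
        have : (π : ℂ) / 8 = ((π / 8 : ℝ) : ℂ) := by push_cast; rfl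
        rw [this, Complex.re_ofReal_mul]; simp
      rw [h7, h8, Complex.add_re, Complex.add_re, Complex.div_ofReal_re, Complex.div_ofReal_re,
        Complex.I_mul_re, h9, Complex.log_re]
      ring
    have hb : -(π / 8) ≤ -(T s).im / (2 * π) ∧ -(T s).im / (2 * π) ≤ π / 8 := by
      rw [le_div_iff₀ (by positivity), div_le_iff₀ (by positivity)]
      constructor <;> nlinarith [(abs_le.1 hTim).1, (abs_le.1 hTim).2]
    rw [hnorm]
    constructor
    · have h1 : √(1 / 2) * √(1 + Real.exp s.re) ≤ √‖1 + Complex.exp s‖ := by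
        rw [← Real.sqrt_mul (by norm_num)]
        apply Real.sqrt_le_sqrt
        have := le_norm_one_add_cexp hs
        linarith
      calc √(1 / 2) * Real.exp (-(π / 8)) * √(1 + Real.exp s.re)
          = (√(1 / 2) * √(1 + Real.exp s.re)) * Real.exp (-(π / 8)) := by ring
        _ ≤ _ := mul_le_mul h1 (Real.exp_le_exp.2 hb.1) (by positivity) (by positivity)
    · rw [mul_comm (Real.exp (π / 8))]
      exact mul_le_mul (Real.sqrt_le_sqrt (norm_one_add_cexp_le s)) (Real.exp_le_exp.2 hb.2)
        (by positivity) (by positivity)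

lemma integral_boundary_strip_eq_zero {H : ℂ → ℂ}
    (hd : ∀ s, |s.im| < π → DifferentiableAt ℂ H s) (R : ℝ) :
    (∫ x : ℝ in (-R)..R, H (x - π / 2 * Complex.I)) - (∫ x : ℝ in (-R)..R, H (x + π / 2 * Complex.I)) +
      Complex.I * (∫ y : ℝ in (-(π / 2))..(π / 2), H (R + y * Complex.I)) -
      Complex.I * (∫ y : ℝ in (-(π / 2))..(π / 2), H (-R + y * Complex.I)) = 0 := by
  have hpi := Real.pi_pos
  have h := Complex.integral_boundary_rect_eq_zero_of_differentiableOn H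
    ⟨-R, -(π / 2)⟩ ⟨R, π / 2⟩ (by
      intro s hs
      refine (hd s ?_).differentiableWithinAt
      have := hs.2
      simp only [mem_preimage] at this
      rw [uIcc_of_le (by linarith)] at this
      rw [abs_lt]
      constructor <;> linarith [this.1, this.2])
  simpa [sub_eq_add_neg] using h

lemma integrable_exp_half_div {z : ℝ} (hz : 0 < z) :
    Integrable (fun x : ℝ => Real.exp (x / 2) / (Real.exp x + z)) ∧
      ∫ x : ℝ, Real.exp (x / 2) / (Real.exp x + z) = π / √z := by
  have hz2 : 0 < √z := Real.sqrt_pos.2 hz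
  have hder : ∀ x : ℝ, HasDerivAt (fun x : ℝ => 2 / √z * Real.arctan (Real.exp (x / 2) / √z))
      (Real.exp (x / 2) / (Real.exp x + z)) x := by
    intro x
    have h1 : HasDerivAt (fun x : ℝ => Real.exp (x / 2) / √z) (Real.exp (x / 2) * (1 / 2) / √z) x :=
      (((hasDerivAt_id x).div_const 2).exp).div_const _
    refine (h1.arctan.const_mul (2 / √z)).congr_deriv ?_
    have h2 : Real.exp x = Real.exp (x / 2) ^ 2 := by rw [← Real.exp_nat_mul]; ring_nf
    have h3 : z = √z ^ 2 := (Real.sq_sqrt hz.le).symm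
    rw [h2]
    nth_rewrite 4 [h3]
    field_simp
    ring
  have hbot : Filter.Tendsto (fun x : ℝ => 2 / √z * Real.arctan (Real.exp (x / 2) / √z))
      Filter.atBot (nhds (2 / √z * Real.arctan (0 / √z))) := by
    apply Filter.Tendsto.const_mul
    apply (Real.continuous_arctan.tendsto _).comp
    apply Filter.Tendsto.div_const
    exact Real.tendsto_exp_atBot.comp (Filter.tendsto_id.atBot_div_const (by norm_num))
  have htop : Filter.Tendsto (fun x : ℝ => 2 / √z * Real.arctan (Real.exp (x / 2) / √z))
      Filter.atTop (nhds (2 / √z * (π / 2))) := by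
    apply Filter.Tendsto.const_mul
    apply (tendsto_nhds_of_tendsto_nhdsWithin Real.tendsto_arctan_atTop).comp
    apply Filter.Tendsto.atTop_div_const hz2
    exact Real.tendsto_exp_atTop.comp (Filter.tendsto_id.atTop_div_const (by norm_num))
  have hcont : Continuous (fun x : ℝ => Real.exp (x / 2) / (Real.exp x + z)) :=
    Continuous.div (by fun_prop) (by fun_prop) (fun x => by positivity)
  have h_int : Integrable (fun x : ℝ => Real.exp (x / 2) / (Real.exp x + z)) := by
    refine integrable_of_intervalIntegral_norm_bounded (l := Filter.atTop) (a := fun R : ℝ => -R)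
      (b := fun R : ℝ => R) (2 / √z * (π / 2))
      (fun R => hcont.integrableOn_Ioc) Filter.tendsto_neg_atTop_atBot Filter.tendsto_id ?_
    filter_upwards with R
    have h4 : (∫ x in (-R)..R, ‖Real.exp (x / 2) / (Real.exp x + z)‖) =
        ∫ x in (-R)..R, Real.exp (x / 2) / (Real.exp x + z) := by
      apply intervalIntegral.integral_congr
      intro x _
      exact Real.norm_of_nonneg (by positivity)
    rw [h4, intervalIntegral.integral_eq_sub_of_hasDerivAt (fun x _ => hder x)
      (hcont.intervalIntegrable _ _), ← mul_sub]
    apply mul_le_mul_of_nonneg_left _ (by positivity)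
    have h5 : 0 ≤ Real.arctan (Real.exp (-R / 2) / √z) := Real.arctan_nonneg.2 (by positivity)
    linarith [Real.arctan_lt_pi_div_two (Real.exp (R / 2) / √z)]
  refine ⟨h_int, ?_⟩
  rw [integral_of_hasDerivAt_of_tendsto hder h_int hbot htop]
  simp

lemma dslope_exp_ne_zero {a s : ℂ} (ha : |a.im| ≤ π / 2) (hs : |s.im| < π) :
    dslope Complex.exp a s ≠ 0 := by
  have hpi := Real.pi_pos
  rcases eq_or_ne s a with rfl | h0
  · rw [dslope_same, Complex.deriv_exp]; exact Complex.exp_ne_zero _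
  · rw [dslope_of_ne _ h0, slope_def_field]
    refine div_ne_zero (fun h => h0 ?_) (sub_ne_zero.2 h0)
    rw [sub_eq_zero, Complex.exp_eq_exp_iff_exists_int] at h
    obtain ⟨n, hn⟩ := h
    have him := congrArg Complex.im hn
    simp only [Complex.add_im, Complex.mul_im, Complex.intCast_re, Complex.intCast_im] at him
    simp at him
    rw [abs_le] at ha
    rw [abs_lt] at hs
    have h1 : (n : ℝ) < 1 := by nlinarith
    have h2 : (-1 : ℝ) < n := by nlinarith
    have h3 : n = 0 := by
      have : n < 1 := by exact_mod_cast h1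
      have : -1 < n := by exact_mod_cast h2
      omega
    rw [hn, h3]; simp

lemma integral_comp_exp_mul (F : ℝ → ℝ) :
    ∫ x : ℝ, Real.exp x * F (Real.exp x) = ∫ u in Ioi (0 : ℝ), F u := by
  have h := integral_image_eq_integral_abs_deriv_smul (s := univ) (f := Real.exp) (f' := Real.exp)
    MeasurableSet.univ (fun x _ => (Real.hasDerivAt_exp x).hasDerivWithinAt)
    Real.exp_injective.injOn F
  rw [image_univ, Real.range_exp] at h
  rw [h, setIntegral_univ]
  simp [abs_of_pos (Real.exp_pos _)]

lemma integrable_comp_exp_mul_iff (F : ℝ → ℝ) :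
    IntegrableOn F (Ioi 0) ↔ Integrable (fun x : ℝ => Real.exp x * F (Real.exp x)) := by
  have h := integrableOn_image_iff_integrableOn_abs_deriv_smul (s := univ) (f := Real.exp)
    (f' := Real.exp) MeasurableSet.univ (fun x _ => (Real.hasDerivAt_exp x).hasDerivWithinAt)
    Real.exp_injective.injOn F
  rw [image_univ, Real.range_exp, integrableOn_univ] at h
  rw [h]
  simp [abs_of_pos (Real.exp_pos _)]

lemma tendsto_exp_half_div_atTop (z : ℝ) :
    Filter.Tendsto (fun R : ℝ => Real.exp (R / 2) / |Real.exp R - z|) Filter.atTop (nhds 0) := by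
  have h1 : Filter.Tendsto (fun R : ℝ => Real.exp (R / 2)) Filter.atTop Filter.atTop :=
    Real.tendsto_exp_atTop.comp (Filter.tendsto_id.atTop_div_const (by norm_num))
  have h2 : Filter.Tendsto (fun R : ℝ => Real.exp (R / 2) - z * (Real.exp (R / 2))⁻¹) Filter.atTop
      Filter.atTop := by
    have := (tendsto_inv_atTop_zero.comp h1).const_mul (-z)
    refine (h1.atTop_add this).congr (fun R => ?_)
    simp only [Function.comp]; ring
  have h3 := (tendsto_inv_atTop_zero.comp h2).abs
  rw [abs_zero] at h3
  refine h3.congr (fun R => ?_)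
  have h4 : Real.exp R = Real.exp (R / 2) * Real.exp (R / 2) := by rw [← Real.exp_add]; ring_nf
  have h5 : Real.exp R - z = Real.exp (R / 2) * (Real.exp (R / 2) - z * (Real.exp (R / 2))⁻¹) := by
    rw [h4]; field_simp
  rw [h5, abs_mul, abs_of_pos (Real.exp_pos _), Function.comp, abs_inv]
  rw [div_mul_eq_div_div, div_self (Real.exp_pos _).ne', one_div]

lemma tendsto_exp_half_div_atBot {z : ℝ} (hz : 0 < z) :
    Filter.Tendsto (fun R : ℝ => Real.exp (R / 2) / |Real.exp R - z|) Filter.atBot (nhds 0) := by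
  have h1 : Filter.Tendsto (fun R : ℝ => Real.exp (R / 2)) Filter.atBot (nhds 0) :=
    Real.tendsto_exp_atBot.comp (Filter.tendsto_id.atBot_div_const (by norm_num))
  have h2 := (Real.tendsto_exp_atBot.sub_const z).abs
  have h3 : Filter.Tendsto (fun R : ℝ => Real.exp (R / 2) / |Real.exp R - z|) Filter.atBot
      (nhds (0 / |0 - z|)) := h1.div h2 (by simpa using hz.ne')
  rwa [zero_div] at h3

/-- A Stieltjes representation on the half-line `-i(0,∞)` of a function on the right half-plane,
written in the coordinate `σ ↦ exp σ`. -/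
lemma stieltjes_exp {Φ : ℂ → ℂ} (hd : ∀ s, |s.im| < π → DifferentiableAt ℂ Φ s) {C : ℝ}
    (hb : ∀ s : ℂ, |s.im| ≤ π / 2 → ‖Φ s‖ ≤ C * Real.exp (-s.re / 2))
    (him : ∀ x : ℝ, (Φ (x - π / 2 * Complex.I)).im = 0) {z : ℝ} (hz : 0 < z) :
    Integrable (fun x : ℝ => (Φ (x + π / 2 * Complex.I)).im * Real.exp x / (Real.exp x + z)) ∧
    ∫ x : ℝ, (Φ (x + π / 2 * Complex.I)).im * Real.exp x / (Real.exp x + z) =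
      -(π * (Φ (Real.log z - π / 2 * Complex.I)).re) := by
  have hpi := Real.pi_pos
  set s₀ : ℂ := Real.log z - π / 2 * Complex.I with hs₀
  have hs₀im : |s₀.im| ≤ π / 2 := by
    rw [hs₀, im_sub_pi_div_two, abs_neg, abs_of_pos (by positivity)]
  have hs₀re : s₀.re = Real.log z := re_sub_pi_div_two _
  have hs₀exp : Complex.exp s₀ = -(z * Complex.I) := by
    rw [hs₀, cexp_sub_pi_div_two, Real.exp_log hz]
  set c := (Φ s₀).re with hc
  have hcΦ : Φ s₀ = c := Complex.ext rfl (by rw [him]; simp)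
  have hzs : Real.exp (Real.log z / 2) = √z := by
    rw [Real.sqrt_eq_rpow, Real.rpow_def_of_pos hz]; ring_nf
  let g : ℂ → ℂ := fun s => Φ s - c * Complex.exp (-(s - s₀) / 2)
  have hg0 : g s₀ = 0 := by simp [g, hcΦ]
  have hgd : ∀ s, |s.im| < π → DifferentiableAt ℂ g s := fun s hs => by
    apply (hd s hs).sub
    fun_prop
  have hopen : IsOpen {s : ℂ | |s.im| < π} :=
    isOpen_lt (Complex.continuous_im.abs) continuous_const
  have hs₀mem : {s : ℂ | |s.im| < π} ∈ nhds s₀ := hopen.mem_nhds (by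
    show |s₀.im| < π
    linarith)
  let H : ℂ → ℂ := fun s => dslope g s₀ s * Complex.exp s / dslope Complex.exp s₀ s
  have hH : ∀ s, |s.im| < π → DifferentiableAt ℂ H s := fun s hs => by
    have hmem : {s : ℂ | |s.im| < π} ∈ nhds s := hopen.mem_nhds hs
    have h1 : DifferentiableOn ℂ (dslope g s₀) {s : ℂ | |s.im| < π} :=
      (Complex.differentiableOn_dslope hs₀mem).2
        (fun s hs => (hgd s hs).differentiableWithinAt)
    have h2 : DifferentiableOn ℂ (dslope Complex.exp s₀) {s : ℂ | |s.im| < π} :=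
      (Complex.differentiableOn_dslope hs₀mem).2 Complex.differentiable_exp.differentiableOn
    exact ((h1.differentiableAt hmem).mul Complex.differentiableAt_exp).div
      (h2.differentiableAt hmem) (dslope_exp_ne_zero hs₀im hs)
  have hHne : ∀ s, s ≠ s₀ → H s = g s * Complex.exp s / (Complex.exp s - Complex.exp s₀) := by
    intro s hs
    have hs' := sub_ne_zero.2 hs
    simp only [H]
    rw [dslope_of_ne _ hs, dslope_of_ne _ hs, slope_def_field, slope_def_field, hg0, sub_zero]
    field_simp
  set M := C + |c| * √z with hM
  have hgb : ∀ s : ℂ, |s.im| ≤ π / 2 → ‖g s‖ ≤ M * Real.exp (-s.re / 2) := by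
    intro s hs
    refine (norm_sub_le _ _).trans ?_
    have h1 : ‖(c : ℂ) * Complex.exp (-(s - s₀) / 2)‖ = |c| * √z * Real.exp (-s.re / 2) := by
      rw [norm_mul, Complex.norm_exp, Complex.norm_real, Real.norm_eq_abs, mul_assoc, ← hzs,
        ← Real.exp_add]
      congr 2
      have : (-(s - s₀) / 2).re = -(s.re - s₀.re) / 2 := by simp
      rw [this, hs₀re]; ring
    rw [h1, hM, add_mul]
    have := hb s hs
    linarith
  have hM0 : 0 ≤ M := by
    have := (norm_nonneg _).trans (hgb s₀ hs₀im)
    exact nonneg_of_mul_nonneg_left this (Real.exp_pos _)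
  have hHb : ∀ x y : ℝ, |y| ≤ π / 2 → x ≠ Real.log z →
      ‖H (x + y * Complex.I)‖ ≤ M * (Real.exp (x / 2) / |Real.exp x - z|) := by
    intro x y hy hx
    have hre : ((x : ℂ) + y * Complex.I).re = x := by simp
    have him' : ((x : ℂ) + y * Complex.I).im = y := by simp
    rw [hHne _ (fun h => hx (by rw [← hre, h, hs₀re])), norm_div, norm_mul, Complex.norm_exp, hre]
    have h1 := hgb (x + y * Complex.I) (by rwa [him'])
    rw [hre] at h1
    have h2 : |Real.exp x - z| ≤ ‖Complex.exp (x + y * Complex.I) - Complex.exp s₀‖ := by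
      have := abs_norm_sub_norm_le (Complex.exp (x + y * Complex.I)) (Complex.exp s₀)
      rwa [Complex.norm_exp, Complex.norm_exp, hre, hs₀re, Real.exp_log hz] at this
    have h3 : 0 < |Real.exp x - z| := by
      rw [abs_pos, sub_ne_zero]
      intro h; apply hx; rw [← h, Real.log_exp]
    have h4 : Real.exp (x / 2) = Real.exp (-x / 2) * Real.exp x := by
      rw [← Real.exp_add]; ring_nf
    rw [h4, ← mul_div_assoc, ← mul_assoc]
    exact div_le_div₀ (by positivity) (mul_le_mul_of_nonneg_right h1 (Real.exp_pos _).le) h3 h2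
  have hvert : ∀ x : ℝ, x ≠ Real.log z →
      ‖∫ y : ℝ in (-(π / 2))..(π / 2), H (x + y * Complex.I)‖ ≤
        M * (Real.exp (x / 2) / |Real.exp x - z|) * π := by
    intro x hx
    have := intervalIntegral.norm_integral_le_of_norm_le_const (a := -(π / 2)) (b := π / 2)
      (f := fun y : ℝ => H (x + y * Complex.I)) (C := M * (Real.exp (x / 2) / |Real.exp x - z|))
      (fun y hy => hHb x y (by
        rw [uIoc_of_le (by linarith)] at hy
        rw [abs_le]; exact ⟨hy.1.le, hy.2⟩) hx)
    refine this.trans (le_of_eq ?_)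
    rw [sub_neg_eq_add, add_halves, abs_of_pos hpi]
  have hvtop : Filter.Tendsto (fun R : ℝ => ∫ y : ℝ in (-(π / 2))..(π / 2), H (R + y * Complex.I))
      Filter.atTop (nhds 0) := by
    apply squeeze_zero_norm' _ (by
      simpa using ((tendsto_exp_half_div_atTop z).const_mul M).mul_const π)
    filter_upwards [Filter.eventually_gt_atTop (Real.log z)] with R hR
    exact hvert R hR.ne'
  have hvbot : Filter.Tendsto (fun R : ℝ => ∫ y : ℝ in (-(π / 2))..(π / 2), H (R + y * Complex.I))
      Filter.atBot (nhds 0) := by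
    apply squeeze_zero_norm' _ (by
      simpa using ((tendsto_exp_half_div_atBot hz).const_mul M).mul_const π)
    filter_upwards [Filter.eventually_lt_atBot (Real.log z)] with R hR
    exact hvert R hR.ne
  have hbotre : ∀ x : ℝ, x ≠ Real.log z → (H (x - π / 2 * Complex.I)).im = 0 := by
    intro x hx
    have hne : (x : ℂ) - π / 2 * Complex.I ≠ s₀ := by
      intro h
      have := congrArg Complex.re h
      rw [re_sub_pi_div_two, hs₀re] at this
      exact hx this
    have h1 : g (x - π / 2 * Complex.I) = (((Φ (x - π / 2 * Complex.I)).re -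
        c * Real.exp (-(x - Real.log z) / 2) : ℝ) : ℂ) := by
      simp only [g, hs₀]
      have h2 : Φ (x - π / 2 * Complex.I) = ((Φ (x - π / 2 * Complex.I)).re : ℂ) :=
        Complex.ext rfl (by rw [him]; simp)
      rw [h2]
      push_cast
      congr 4
      simp
    have h3 : Real.exp x - z ≠ 0 := by
      rw [sub_ne_zero]
      intro h; apply hx; rw [← h, Real.log_exp]
    rw [hHne _ hne, cexp_sub_pi_div_two, hs₀exp, h1]
    generalize (Φ (x - π / 2 * Complex.I)).re - c * Real.exp (-(x - Real.log z) / 2) = a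
    have h4 : (a : ℂ) * -(Real.exp x * Complex.I) / (-(Real.exp x * Complex.I) - -(z * Complex.I)) =
        ((a * Real.exp x / (Real.exp x - z) : ℝ) : ℂ) := by
      have h5 : (Real.exp x : ℂ) - z ≠ 0 := by exact_mod_cast h3
      have h6 : -(Real.exp x * Complex.I) - -(z * Complex.I) = -Complex.I * (Real.exp x - z) := by ring
      rw [h6, Complex.ofReal_div, Complex.ofReal_mul, Complex.ofReal_sub,
        div_eq_div_iff (mul_ne_zero (neg_ne_zero.2 Complex.I_ne_zero) h5) h5]
      ring
    rw [h4, Complex.ofReal_im]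
  have htopim : ∀ x : ℝ, (H (x + π / 2 * Complex.I)).im =
      (Φ (x + π / 2 * Complex.I)).im * Real.exp x / (Real.exp x + z) +
        c * √z * (Real.exp (x / 2) / (Real.exp x + z)) := by
    intro x
    have hne : (x : ℂ) + π / 2 * Complex.I ≠ s₀ := by
      intro h
      have := congrArg Complex.im h
      rw [im_add_pi_div_two, hs₀, im_sub_pi_div_two] at this
      linarith
    have h1 : g (x + π / 2 * Complex.I) = Φ (x + π / 2 * Complex.I) +
        ((c * √z * Real.exp (-x / 2) : ℝ) : ℂ) * Complex.I := by
      simp only [g, hs₀]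
      have h2 : -((x : ℂ) + π / 2 * Complex.I - (Real.log z - π / 2 * Complex.I)) / 2 =
          ((-x / 2 + Real.log z / 2 : ℝ) : ℂ) - π / 2 * Complex.I := by
        push_cast; ring
      rw [h2, cexp_sub_pi_div_two, Real.exp_add, hzs]
      push_cast; ring
    have h3 : Real.exp x + z ≠ 0 := by positivity
    have h7 : Real.exp (x / 2) = Real.exp (-x / 2) * Real.exp x := by
      rw [← Real.exp_add]; ring_nf
    rw [hHne _ hne, cexp_add_pi_div_two, hs₀exp, h1, h7]
    set a := Real.exp (-x / 2)
    have h5 : (Real.exp x : ℂ) + z ≠ 0 := by exact_mod_cast h3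
    have h6 : (Real.exp x : ℂ) * Complex.I - -(z * Complex.I) = Complex.I * (Real.exp x + z) := by ring
    have h8 : (Φ (x + π / 2 * Complex.I) + ((c * √z * a : ℝ) : ℂ) * Complex.I) *
        (Real.exp x * Complex.I) / (Complex.I * (Real.exp x + z)) =
        (Φ (x + π / 2 * Complex.I) + ((c * √z * a : ℝ) : ℂ) * Complex.I) *
        ((Real.exp x / (Real.exp x + z) : ℝ) : ℂ) := by
      push_cast
      simp only [← Complex.ofReal_exp]
      field_simp
    rw [h6, h8, Complex.im_mul_ofReal, Complex.add_im, Complex.im_ofReal_mul, Complex.I_im]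
    ring
  have hcontΦ : Continuous (fun x : ℝ => Φ (x + π / 2 * Complex.I)) := by
    rw [continuous_iff_continuousAt]
    intro x
    have h1 := (hd (x + π / 2 * Complex.I) (by
      rw [im_add_pi_div_two, abs_of_pos (by positivity)]; linarith)).continuousAt
    exact ContinuousAt.comp (f := fun x : ℝ => (x : ℂ) + π / 2 * Complex.I) h1 (by fun_prop)
  have hIE := integrable_exp_half_div hz
  have h_int : Integrable
      (fun x : ℝ => (Φ (x + π / 2 * Complex.I)).im * Real.exp x / (Real.exp x + z)) := by
    refine (hIE.1.const_mul C).mono' ?_ ?_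
    · apply Continuous.aestronglyMeasurable
      exact Continuous.div ((Complex.continuous_im.comp hcontΦ).mul Real.continuous_exp)
        (by fun_prop) (fun x => by positivity)
    · filter_upwards with x
      have h1 := hb (x + π / 2 * Complex.I) (by
        rw [im_add_pi_div_two, abs_of_pos (by positivity)])
      rw [re_add_pi_div_two] at h1
      have h2 := (Complex.abs_im_le_norm _).trans h1
      have h7 : Real.exp (x / 2) = Real.exp (-x / 2) * Real.exp x := by
        rw [← Real.exp_add]; ring_nf
      rw [norm_div, norm_mul, Real.norm_eq_abs, Real.norm_of_nonneg (Real.exp_pos x).le,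
        Real.norm_of_nonneg (by positivity), h7, ← mul_div_assoc, ← mul_assoc]
      gcongr
  refine ⟨h_int, ?_⟩
  have hHcont : ∀ y : ℝ, |y| < π → Continuous (fun x : ℝ => H (x + y * Complex.I)) := by
    intro y hy
    rw [continuous_iff_continuousAt]
    intro x
    have h1 := (hH (x + y * Complex.I) (by simpa using hy)).continuousAt
    exact ContinuousAt.comp (f := fun x : ℝ => (x : ℂ) + y * Complex.I) h1 (by fun_prop)
  have hHint : Integrable (fun x : ℝ => (H (x + π / 2 * Complex.I)).im) := by
    simp_rw [htopim]
    exact h_int.add (hIE.1.const_mul _)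
  have hcb : Continuous (fun x : ℝ => H (x - π / 2 * Complex.I)) := by
    have := hHcont (-(π / 2)) (by rw [abs_neg, abs_of_pos] <;> linarith)
    simpa [sub_eq_add_neg] using this
  have hct : Continuous (fun x : ℝ => H (x + π / 2 * Complex.I)) := by
    have := hHcont (π / 2) (by rw [abs_of_pos] <;> linarith)
    simpa using this
  have hlim1 := intervalIntegral_tendsto_integral hHint Filter.tendsto_neg_atTop_atBot
    Filter.tendsto_id (l := Filter.atTop)
  have hlim2 : Filter.Tendsto (fun R : ℝ => ∫ x in (-R)..R, (H (x + π / 2 * Complex.I)).im)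
      Filter.atTop (nhds 0) := by
    have h1 : Filter.Tendsto (fun R : ℝ =>
        ((Complex.I * (∫ y : ℝ in (-(π / 2))..(π / 2), H (R + y * Complex.I)) -
          Complex.I * (∫ y : ℝ in (-(π / 2))..(π / 2), H ((-R : ℝ) + y * Complex.I)))).im)
        Filter.atTop (nhds ((Complex.I * 0 - Complex.I * 0).im)) := by
      apply (Complex.continuous_im.tendsto _).comp
      exact (hvtop.const_mul _).sub
        ((hvbot.comp Filter.tendsto_neg_atTop_atBot).const_mul _)
    simp only [mul_zero, sub_zero, Complex.zero_im] at h1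
    refine h1.congr (fun R => ?_)
    have h2 := integral_boundary_strip_eq_zero hH R
    have h3 : ∫ x in (-R)..R, (H (x + π / 2 * Complex.I)).im =
        (∫ x in (-R)..R, H (x + π / 2 * Complex.I)).im :=
      (Complex.imCLM.intervalIntegral_comp_comm (hct.intervalIntegrable _ _))
    have h4 : (∫ x in (-R)..R, H (x - π / 2 * Complex.I)).im = 0 := by
      have h5 := (Complex.imCLM.intervalIntegral_comp_comm (hcb.intervalIntegrable (μ := volume) (-R) R))
      simp only [Complex.imCLM_apply] at h5
      rw [← h5]
      apply intervalIntegral.integral_zero_ae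
      have : ∀ᵐ x : ℝ, x ≠ Real.log z := by simp [ae_iff, measure_singleton]
      filter_upwards [this] with x hx _
      exact hbotre x hx
    have h6 := congrArg Complex.im h2
    rw [Complex.sub_im, Complex.add_im, Complex.sub_im, h4, Complex.zero_im] at h6
    rw [h3, Complex.sub_im]
    push_cast
    linarith
  have h0 := tendsto_nhds_unique hlim1 hlim2
  simp_rw [htopim] at h0
  rw [integral_add h_int (hIE.1.const_mul _), integral_const_mul, hIE.2] at h0
  have : c * √z * (π / √z) = π * c := by
    have := (Real.sqrt_pos.2 hz).ne'
    field_simp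
  linarith

lemma stieltjes {Φ : ℂ → ℂ} (hd : ∀ s, |s.im| < π → DifferentiableAt ℂ Φ s) {C : ℝ}
    (hb : ∀ s : ℂ, |s.im| ≤ π / 2 → ‖Φ s‖ ≤ C * Real.exp (-s.re / 2))
    (him : ∀ x : ℝ, (Φ (x - π / 2 * Complex.I)).im = 0) {G : ℝ → ℝ}
    (hG : ∀ x : ℝ, (Φ (x + π / 2 * Complex.I)).im = -(π * G (Real.exp x))) {z : ℝ} (hz : 0 < z) :
    IntegrableOn (fun u => G u / (z + u)) (Ioi 0) ∧
    ∫ u in Ioi (0 : ℝ), G u / (z + u) = (Φ (Real.log z - π / 2 * Complex.I)).re := by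
  have hpi := Real.pi_pos
  obtain ⟨h1, h2⟩ := stieltjes_exp hd hb him hz
  have h3 : ∀ x : ℝ, (Φ (x + π / 2 * Complex.I)).im * Real.exp x / (Real.exp x + z) =
      -π * (Real.exp x * (G (Real.exp x) / (z + Real.exp x))) := by
    intro x
    rw [hG, add_comm z]; ring
  simp_rw [h3] at h1 h2
  rw [integral_const_mul, integral_comp_exp_mul (fun u => G u / (z + u))] at h2
  refine ⟨?_, ?_⟩
  · rw [integrable_comp_exp_mul_iff (fun u => G u / (z + u))]
    refine (h1.const_mul (-π)⁻¹).congr ?_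
    filter_upwards with x
    field_simp
  · have : π * (∫ u in Ioi (0 : ℝ), G u / (z + u)) =
        π * (Φ (Real.log z - π / 2 * Complex.I)).re := by linarith
    exact mul_left_cancel₀ hpi.ne' this

lemma exp_etaF_bounds : ∃ c C : ℝ, 0 < c ∧ 0 < C ∧ ∀ u, 0 < u →
    c * √(1 + u) ≤ Real.exp (etaF u) ∧ Real.exp (etaF u) ≤ C * √(1 + u) := by
  obtain ⟨K, -, -, hb, -, -, c, C, hc, hC, hK⟩ := exists_wienerHopf_factor
  refine ⟨c, C, hc, hC, fun u hu => ?_⟩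
  have h := hK (Real.log u - π / 2 * Complex.I) (by
    rw [im_sub_pi_div_two, abs_neg, abs_of_pos (by positivity)])
  rwa [hb, re_sub_pi_div_two, Real.exp_log hu, Complex.norm_real, Real.norm_eq_abs,
    Real.abs_exp] at h

lemma exp_neg_half_eq (x : ℝ) : Real.exp (-x / 2) = (√(Real.exp x))⁻¹ := by
  rw [neg_div, Real.exp_neg, Real.exp_half]

lemma integral_fexit_div {z : ℝ} (hz : 0 < z) :
    IntegrableOn (fun u => fexit u / (z + u)) (Ioi 0) ∧
    ∫ u in Ioi (0 : ℝ), fexit u / (z + u) = 1 / Real.exp (etaF z) := by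
  obtain ⟨K, hd, h0, hb, ht, -, c, C, hc, hC, hK⟩ := exists_wienerHopf_factor
  have h := stieltjes (Φ := fun s => (K s)⁻¹) (C := c⁻¹) (G := fexit)
    (fun s hs => (hd s hs).inv (h0 s)) (fun s hs => ?_) (fun x => ?_) (fun x => ?_) hz
  · rw [hb, Real.exp_log hz] at h
    refine ⟨h.1, h.2.trans ?_⟩
    rw [← Complex.ofReal_inv, Complex.ofReal_re, one_div]
  · rw [norm_inv, exp_neg_half_eq, ← mul_inv]
    apply inv_anti₀ (by positivity)
    refine le_trans ?_ (hK s hs).1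
    gcongr
    linarith
  · rw [hb, ← Complex.ofReal_inv, Complex.ofReal_im]
  · simp only [ht]
    set u := Real.exp x
    set k := Real.exp (etaF u)
    have hk : (k : ℂ) ≠ 0 := by exact_mod_cast (Real.exp_pos _).ne'
    have hne : 1 + (u : ℂ) * Complex.I ≠ 0 := by
      intro h; have := congrArg Complex.re h; simp at this
    have hu : (1 + (u : ℂ) ^ 2) ≠ 0 := by exact_mod_cast (by positivity : (1 + u ^ 2) ≠ 0)
    have h1 : ((1 + (u : ℂ) * Complex.I) / k)⁻¹ = ((k / (1 + u ^ 2) : ℝ) : ℂ) * (1 - u * Complex.I) := by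
      push_cast
      field_simp
      ring_nf
      simp only [Complex.I_sq]; ring
    rw [h1, Complex.im_ofReal_mul]
    simp only [Complex.sub_im, Complex.one_im, Complex.im_ofReal_mul, Complex.I_im]
    unfold fexit
    have := Real.pi_pos.ne'
    field_simp
    ring

lemma integral_kernel_div {a b z : ℝ} (ha : 0 < a) (hb : 0 < b) (hz : 0 < z) :
    IntegrableOn (fun u => 1 / π * ((a + b) * u * Real.exp (etaF (a * u)) * Real.exp (etaF (b * u)) /
      ((1 + (a * u) ^ 2) * (1 + (b * u) ^ 2))) / (z + u)) (Ioi 0) ∧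
    ∫ u in Ioi (0 : ℝ), 1 / π * ((a + b) * u * Real.exp (etaF (a * u)) * Real.exp (etaF (b * u)) /
      ((1 + (a * u) ^ 2) * (1 + (b * u) ^ 2))) / (z + u) =
      1 / (Real.exp (etaF (a * z)) * Real.exp (etaF (b * z))) := by
  obtain ⟨K, hd, h0, hbo, ht, -, c, C, hc, hC, hK⟩ := exists_wienerHopf_factor
  have hadd : ∀ (a x : ℝ), 0 < a → Real.exp (x + Real.log a) = a * Real.exp x := fun a x ha => by
    rw [Real.exp_add, Real.exp_log ha, mul_comm]
  have hsub : ∀ (a x : ℝ), 0 < a → K (x - π / 2 * Complex.I + Real.log a) =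
      Real.exp (etaF (a * Real.exp x)) := fun a x ha => by
    rw [← hadd a x ha, ← hbo]; push_cast; ring_nf
  have hadt : ∀ (a x : ℝ), 0 < a → K (x + π / 2 * Complex.I + Real.log a) =
      (1 + (a * Real.exp x : ℝ) * Complex.I) / Real.exp (etaF (a * Real.exp x)) := fun a x ha => by
    rw [← hadd a x ha, ← ht]; push_cast; ring_nf
  have h := stieltjes (Φ := fun s => (K (s + Real.log a) * K (s + Real.log b))⁻¹)
    (C := (c * √a * c)⁻¹)
    (G := fun u => 1 / π * ((a + b) * u * Real.exp (etaF (a * u)) * Real.exp (etaF (b * u)) /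
      ((1 + (a * u) ^ 2) * (1 + (b * u) ^ 2))))
    (fun s hs => ?_) (fun s hs => ?_) (fun x => ?_) (fun x => ?_) hz
  · simp only [hsub _ _ ha, hsub _ _ hb, Real.exp_log hz] at h
    refine ⟨h.1, h.2.trans ?_⟩
    rw [← Complex.ofReal_mul, ← Complex.ofReal_inv, Complex.ofReal_re, one_div]
  · refine DifferentiableAt.inv (DifferentiableAt.mul ?_ ?_) (mul_ne_zero (h0 _) (h0 _))
    · exact DifferentiableAt.comp (g := K) s (hd _ (by simpa using hs)) (by fun_prop)
    · exact DifferentiableAt.comp (g := K) s (hd _ (by simpa using hs)) (by fun_prop)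
  · rw [norm_inv, exp_neg_half_eq, ← mul_inv, norm_mul]
    apply inv_anti₀ (by positivity)
    have h1 := (hK (s + Real.log a) (by simpa using hs)).1
    have h2 := (hK (s + Real.log b) (by simpa using hs)).1
    rw [Complex.add_re, Complex.ofReal_re, hadd _ _ ha] at h1
    rw [Complex.add_re, Complex.ofReal_re, hadd _ _ hb] at h2
    have h3 : √a * √(Real.exp s.re) ≤ √(1 + a * Real.exp s.re) := by
      rw [← Real.sqrt_mul ha.le]
      apply Real.sqrt_le_sqrt; linarith
    have h4 : 1 ≤ √(1 + b * Real.exp s.re) := by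
      rw [Real.one_le_sqrt]
      have : 0 < b * Real.exp s.re := by positivity
      linarith
    calc c * √a * c * √(Real.exp s.re) = (c * (√a * √(Real.exp s.re))) * (c * 1) := by ring
      _ ≤ (c * √(1 + a * Real.exp s.re)) * (c * √(1 + b * Real.exp s.re)) := by gcongr
      _ ≤ _ := by gcongr
  · rw [hsub _ _ ha, hsub _ _ hb, ← Complex.ofReal_mul, ← Complex.ofReal_inv, Complex.ofReal_im]
  · simp only [hadt _ _ ha, hadt _ _ hb]
    set w := Real.exp x
    rw [show (a + b) * w = a * w + b * w by ring]
    set u := a * w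
    set v := b * w
    set k := Real.exp (etaF u)
    set l := Real.exp (etaF v)
    have hk : (k : ℂ) ≠ 0 := by exact_mod_cast (Real.exp_pos _).ne'
    have hl : (l : ℂ) ≠ 0 := by exact_mod_cast (Real.exp_pos _).ne'
    have hne : ∀ u : ℝ, 1 + (u : ℂ) * Complex.I ≠ 0 := by
      intro u h; have := congrArg Complex.re h; simp at this
    have hu : ∀ u : ℝ, (1 + (u : ℂ) ^ 2) ≠ 0 := fun u => by
      exact_mod_cast (by positivity : (1 + u ^ 2) ≠ 0)
    have h1 : ∀ (u k : ℝ), (k : ℂ) ≠ 0 → (1 + (u : ℂ) * Complex.I) / k =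
        (((k / (1 + u ^ 2) : ℝ) : ℂ) * (1 - u * Complex.I))⁻¹ := by
      intro u k hk
      have := hne u
      have := hu u
      have h9 : (1 - (u : ℂ) * Complex.I) ≠ 0 := by
        intro h; have := congrArg Complex.re h; simp at this
      push_cast
      field_simp
      ring_nf
      simp only [Complex.I_sq]; ring
    rw [h1 u k hk, h1 v l hl, ← mul_inv, inv_inv]
    have h2 : ((k / (1 + u ^ 2) : ℝ) : ℂ) * (1 - u * Complex.I) *
        (((l / (1 + v ^ 2) : ℝ) : ℂ) * (1 - v * Complex.I)) =
        ((k / (1 + u ^ 2) * (l / (1 + v ^ 2)) : ℝ) : ℂ) *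
          (((1 - u * v : ℝ) : ℂ) - ((u + v : ℝ) : ℂ) * Complex.I) := by
      push_cast; ring_nf
      simp only [Complex.I_sq]; ring
    rw [h2, Complex.im_ofReal_mul, Complex.sub_im, Complex.im_ofReal_mul, Complex.I_im,
      Complex.ofReal_im]
    have := Real.pi_pos.ne'
    field_simp
    ring

lemma exp_two_mul_ne_one {s : ℂ} (hs : |s.im| < π) (h0 : s ≠ 0) :
    1 - Complex.exp (2 * s) ≠ 0 := by
  intro h
  rw [sub_eq_zero, eq_comm, Complex.exp_eq_one_iff] at h
  obtain ⟨n, hn⟩ := h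
  have hpi := Real.pi_pos
  have hs' : s = n * (π * Complex.I) := by
    have : (2 : ℂ) ≠ 0 := two_ne_zero
    apply mul_left_cancel₀ this
    rw [hn]; ring
  have him : s.im = n * π := by rw [hs']; simp
  rw [abs_lt, him] at hs
  have h1 : (n : ℝ) < 1 := by nlinarith
  have h2 : (-1 : ℝ) < n := by nlinarith
  have h3 : n = 0 := by
    have : n < 1 := by exact_mod_cast h1
    have : -1 < n := by exact_mod_cast h2
    omega
  exact h0 (by rw [hs', h3]; simp)

lemma half_le_norm_one_sub_exp_two_mul {s : ℂ} (hs : 1 ≤ |s.re|) :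
    (1 + Real.exp s.re ^ 2) / 4 ≤ ‖1 - Complex.exp (2 * s)‖ := by
  have h1 : |1 - Real.exp s.re ^ 2| ≤ ‖1 - Complex.exp (2 * s)‖ := by
    have := abs_norm_sub_norm_le (1 : ℂ) (Complex.exp (2 * s))
    rw [norm_one, Complex.norm_exp] at this
    convert this using 3
    rw [← Real.exp_nat_mul]; simp
  refine le_trans ?_ h1
  have he := Real.exp_pos s.re
  have h2 : 2 < Real.exp 1 := by linarith [Real.exp_one_gt_d9]
  rcases le_abs.1 hs with h | h
  · have h3 := Real.exp_le_exp.2 h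
    rw [abs_of_neg (by nlinarith)]
    nlinarith
  · have h3 := Real.exp_le_exp.2 h
    have h4 : Real.exp s.re < 1 / 2 := by
      rw [Real.exp_neg] at h3
      have h5 : 2 < (Real.exp s.re)⁻¹ := by linarith
      rw [lt_inv_comm₀ (by norm_num) he] at h5
      linarith
    rw [abs_of_pos (by nlinarith)]
    nlinarith

lemma integral_remainder_div {z : ℝ} (hz : 0 < z) :
    IntegrableOn (fun u => -(1 / π * (u / ((1 + u ^ 2) * Real.exp (etaF u)))) / (z + u)) (Ioi 0) ∧
    ∫ u in Ioi (0 : ℝ), -(1 / π * (u / ((1 + u ^ 2) * Real.exp (etaF u)))) / (z + u) =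
      (Real.exp (etaF z) - √2 * (Real.cos (π / 8) + z * Real.sin (π / 8))) / (1 + z ^ 2) := by
  obtain ⟨K, hd, h0, hb, ht, hK0, c, C, hc, hC, hK⟩ := exists_wienerHopf_factor
  have hpi := Real.pi_pos
  let N : ℂ → ℂ := fun s => K s - √2 * (Real.cos (π / 8) + Real.sin (π / 8) * (Complex.I * Complex.exp s))
  let D : ℂ → ℂ := fun s => 1 - Complex.exp (2 * s)
  have hN0 : N 0 = 0 := by simp only [N, hK0, Complex.exp_zero, mul_one]; ring
  have hD0 : D 0 = 0 := by simp [D]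
  have hopen : IsOpen {s : ℂ | |s.im| < π} :=
    isOpen_lt (Complex.continuous_im.abs) continuous_const
  have hmem0 : {s : ℂ | |s.im| < π} ∈ nhds 0 := hopen.mem_nhds (by simpa using hpi)
  have hDd : Differentiable ℂ D := by fun_prop
  have hDderiv : deriv D 0 = -2 := by
    have : HasDerivAt D (-2) 0 := by
      have h1 := (((hasDerivAt_id (0 : ℂ)).const_mul 2).cexp).const_sub 1
      refine h1.congr_deriv ?_
      simp
    exact this.deriv
  have hDne : ∀ s, |s.im| < π → dslope D 0 s ≠ 0 := by
    intro s hs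
    rcases eq_or_ne s 0 with rfl | hs0
    · rw [dslope_same, hDderiv]; norm_num
    · rw [dslope_of_ne _ hs0, slope_def_field, hD0]
      simp only [sub_zero]
      exact div_ne_zero (exp_two_mul_ne_one hs hs0) hs0
  let Φ : ℂ → ℂ := fun s => dslope N 0 s / dslope D 0 s
  have hΦd : ∀ s, |s.im| < π → DifferentiableAt ℂ Φ s := by
    intro s hs
    have hmem : {s : ℂ | |s.im| < π} ∈ nhds s := hopen.mem_nhds hs
    have h1 : DifferentiableOn ℂ (dslope N 0) {s : ℂ | |s.im| < π} := by
      refine (Complex.differentiableOn_dslope hmem0).2 (fun s hs => ?_)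
      apply DifferentiableAt.differentiableWithinAt
      apply (hd s hs).sub
      fun_prop
    have h2 : DifferentiableOn ℂ (dslope D 0) {s : ℂ | |s.im| < π} :=
      (Complex.differentiableOn_dslope hmem0).2 hDd.differentiableOn
    exact (h1.differentiableAt hmem).div (h2.differentiableAt hmem) (hDne s hs)
  have hΦne : ∀ s, s ≠ 0 → Φ s = N s / D s := by
    intro s hs
    simp only [Φ]
    rw [dslope_of_ne _ hs, dslope_of_ne _ hs, slope_def_field, slope_def_field, hN0, hD0]
    simp only [sub_zero]
    field_simp
  have hNb : ∀ s : ℂ, |s.im| ≤ π / 2 → ‖N s‖ ≤ (C + 4) * (1 + Real.exp s.re) := by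
    intro s hs
    have he := Real.exp_pos s.re
    have h1 := (hK s hs).2
    have h2 : √(1 + Real.exp s.re) ≤ 1 + Real.exp s.re := by
      apply Real.sqrt_le_iff.2 ⟨by positivity, by nlinarith⟩
    have h3 : ‖(√2 : ℂ) * (Real.cos (π / 8) + Real.sin (π / 8) * (Complex.I * Complex.exp s))‖ ≤
        2 * (1 + Real.exp s.re) := by
      rw [norm_mul]
      apply mul_le_mul _ _ (norm_nonneg _) (by norm_num)
      · rw [Complex.norm_real, Real.norm_of_nonneg (Real.sqrt_nonneg _)]
        apply Real.sqrt_le_iff.2; norm_num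
      · refine (norm_add_le _ _).trans ?_
        rw [norm_mul, norm_mul, Complex.norm_I, one_mul, Complex.norm_exp, Complex.norm_real,
          Complex.norm_real]
        apply add_le_add (Real.abs_cos_le_one _)
        exact mul_le_of_le_one_left he.le (Real.abs_sin_le_one _)
    refine (norm_sub_le _ _).trans ?_
    nlinarith
  have hcompact : IsCompact (Icc (-1 : ℝ) 1 ×ℂ Icc (-(π / 2)) (π / 2)) :=
    isCompact_Icc.reProdIm isCompact_Icc
  obtain ⟨B, hB⟩ := hcompact.exists_bound_of_continuousOn (f := Φ) (fun s hs => by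
    have h2 := hs.2
    simp only [mem_preimage] at h2
    exact (hΦd s (by rw [abs_lt]; constructor <;> linarith [h2.1, h2.2])).continuousAt.continuousWithinAt)
  have hB0 : 0 ≤ B := (norm_nonneg _).trans (hB 0 ⟨by simp, by simp; positivity⟩)
  have hΦb : ∀ s : ℂ, |s.im| ≤ π / 2 →
      ‖Φ s‖ ≤ (B * Real.exp (1 / 2) + 8 * (C + 4)) * Real.exp (-s.re / 2) := by
    intro s hs
    have he := Real.exp_pos (-s.re / 2)
    rcases le_or_gt |s.re| 1 with h | h
    · have h1 := hB s ⟨abs_le.1 h, abs_le.1 hs⟩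
      have h2 : 1 ≤ Real.exp (1 / 2) * Real.exp (-s.re / 2) := by
        rw [← Real.exp_add, Real.one_le_exp_iff]
        linarith [(abs_le.1 h).2]
      have h3 : 0 ≤ 8 * (C + 4) * Real.exp (-s.re / 2) := by positivity
      nlinarith
    · have hs0 : s ≠ 0 := by rintro rfl; simp at h; linarith
      have h1 := half_le_norm_one_sub_exp_two_mul h.le
      have h2 := hNb s hs
      rw [hΦne s hs0, norm_div]
      have h4 : ‖N s‖ / ‖D s‖ ≤ (C + 4) * (1 + Real.exp s.re) / ((1 + Real.exp s.re ^ 2) / 4) :=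
        div_le_div₀ (by positivity) h2 (by positivity) h1
      refine h4.trans ?_
      have h5 : 0 ≤ B * Real.exp (1 / 2) * Real.exp (-s.re / 2) := by positivity
      have h6 : (C + 4) * (1 + Real.exp s.re) / ((1 + Real.exp s.re ^ 2) / 4) ≤
          8 * (C + 4) * Real.exp (-s.re / 2) := by
        have hx : Real.exp s.re = ((Real.exp (-s.re / 2)) ^ 2)⁻¹ := by
          rw [← Real.exp_nat_mul, ← Real.exp_neg]; congr 1; push_cast; ring
        rw [hx]
        set w := Real.exp (-s.re / 2)
        rw [div_le_iff₀ (by positivity)]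
        have h7 : 1 + (w ^ 2)⁻¹ ≤ 2 * w * (1 + (w ^ 2)⁻¹ ^ 2) := by
          have h8 : 2 * w * (1 + (w ^ 2)⁻¹ ^ 2) = 2 * w * (w ^ 4 + 1) / w ^ 4 := by
            field_simp
          have h9 : 1 + (w ^ 2)⁻¹ = (w ^ 4 + w ^ 2) / w ^ 4 := by field_simp
          rw [h8, h9]
          apply div_le_div_of_nonneg_right _ (by positivity)
          have : 0 ≤ w * (2 * (w ^ 4 + 1) - w ^ 3 - w) := by
            apply mul_nonneg he.le
            nlinarith [sq_nonneg (w ^ 2 - 1), sq_nonneg (w - 1), sq_nonneg (w ^ 2 - w), sq_nonneg w, sq_nonneg (w^2)]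
          nlinarith
        nlinarith
      nlinarith
  have hrb : ∀ x : ℝ, Φ (x - π / 2 * Complex.I) = (((Real.exp (etaF (Real.exp x)) - √2 *
      (Real.cos (π / 8) + Real.exp x * Real.sin (π / 8))) / (1 + Real.exp x ^ 2) : ℝ) : ℂ) := by
    intro x
    rw [hΦne _ (fun h => by
      have := congrArg Complex.im h
      rw [im_sub_pi_div_two, Complex.zero_im] at this; linarith)]
    have h1 : Complex.exp (2 * (x - π / 2 * Complex.I)) = -((Real.exp x : ℂ) ^ 2) := by
      rw [two_mul, Complex.exp_add, cexp_sub_pi_div_two]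
      ring_nf; simp only [Complex.I_sq]; ring
    simp only [N, D]
    rw [h1, hb, cexp_sub_pi_div_two]
    push_cast
    simp only [← Complex.ofReal_exp]
    congr 1
    · ring_nf; simp only [Complex.I_sq]; ring
    · ring
  have h := stieltjes (Φ := Φ) (G := fun u => -(1 / π * (u / ((1 + u ^ 2) * Real.exp (etaF u)))))
    hΦd hΦb (fun x => by rw [hrb, Complex.ofReal_im]) (fun x => ?_) hz
  · rw [hrb, Complex.ofReal_re, Real.exp_log hz] at h
    exact h
  · rw [hΦne _ (fun h => by
      have := congrArg Complex.im h
      rw [im_add_pi_div_two, Complex.zero_im] at this; linarith)]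
    have h1 : Complex.exp (2 * (x + π / 2 * Complex.I)) = -((Real.exp x : ℂ) ^ 2) := by
      rw [two_mul, Complex.exp_add, cexp_add_pi_div_two]
      ring_nf; simp only [Complex.I_sq]; ring
    simp only [N, D]
    rw [h1, ht, cexp_add_pi_div_two]
    set u := Real.exp x
    set k := Real.exp (etaF u)
    have hk : (k : ℂ) ≠ 0 := by exact_mod_cast (Real.exp_pos _).ne'
    have hu : (1 + (u : ℂ) ^ 2) ≠ 0 := by exact_mod_cast (by positivity : (1 + u ^ 2) ≠ 0)
    have h2 : ((1 + (u : ℂ) * Complex.I) / k - √2 * (Real.cos (π / 8) +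
        Real.sin (π / 8) * (Complex.I * (u * Complex.I)))) / (1 - -((u : ℂ) ^ 2)) =
        (((1 / k - √2 * (Real.cos (π / 8) - Real.sin (π / 8) * u)) / (1 + u ^ 2) : ℝ) : ℂ) +
        ((u / (k * (1 + u ^ 2)) : ℝ) : ℂ) * Complex.I := by
      have h3 : (1 - -((u : ℂ) ^ 2)) = 1 + (u : ℂ) ^ 2 := by ring
      have h4 : Complex.I * ((u : ℂ) * Complex.I) = -u := by
        ring_nf; simp only [Complex.I_sq]; ring
      rw [h3, h4]
      simp only [Complex.ofReal_div, Complex.ofReal_sub, Complex.ofReal_mul, Complex.ofReal_add,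
        Complex.ofReal_one, Complex.ofReal_pow]
      field_simp
      ring
    rw [h2, Complex.add_im, Complex.im_ofReal_mul, Complex.ofReal_im, Complex.I_im]
    field_simp
    ring

lemma integrableOn_rfun_density :
    IntegrableOn (fun u : ℝ => (u / (1 + u ^ 2)) * Real.exp (-etaF u)) (Ioi 0) := by
  obtain ⟨c, C, hc, hC, hκ⟩ := exp_etaF_bounds
  have h1 : IntegrableOn (fun u : ℝ => (2 / c) * (u + 1) ^ (-(3 / 2) : ℝ)) (Ioi 0) :=
    (integrableOn_add_rpow_Ioi_of_lt (by norm_num) (by norm_num)).const_mul _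
  refine h1.mono' ?_ ?_
  · apply Continuous.aestronglyMeasurable
    exact (Continuous.div (by fun_prop) (by fun_prop) (fun x => by positivity)).mul
      (Real.continuous_exp.comp continuous_etaF.neg)
  · rw [ae_restrict_iff' measurableSet_Ioi]
    filter_upwards with u hu
    have hu : 0 < u := hu
    rw [Real.norm_of_nonneg (by positivity), Real.exp_neg]
    have h2 : (Real.exp (etaF u))⁻¹ ≤ (c * √(1 + u))⁻¹ := inv_anti₀ (by positivity) (hκ u hu).1
    have h3 : u / (1 + u ^ 2) ≤ 2 / (1 + u) := by
      rw [div_le_div_iff₀ (by positivity) (by positivity)]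
      nlinarith [sq_nonneg (u - 1)]
    have h4 : (u + 1) ^ (-(3 / 2) : ℝ) = (1 + u)⁻¹ * (√(1 + u))⁻¹ := by
      rw [Real.sqrt_eq_rpow, add_comm u, ← Real.rpow_neg (by positivity), ← Real.rpow_neg_one,
        ← Real.rpow_add (by positivity)]
      norm_num
    calc u / (1 + u ^ 2) * (Real.exp (etaF u))⁻¹ ≤ 2 / (1 + u) * (c * √(1 + u))⁻¹ := by gcongr
      _ = _ := by rw [h4]; field_simp

lemma rfun_bounded : ∃ M : ℝ, ∀ x, 0 < x → |rfun x| ≤ M := by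
  refine ⟨|√2 / (2 * π)| * ∫ u in Ioi (0 : ℝ), (u / (1 + u ^ 2)) * Real.exp (-etaF u),
    fun x hx => ?_⟩
  unfold rfun
  rw [abs_mul]
  apply mul_le_mul_of_nonneg_left _ (abs_nonneg _)
  rw [← Real.norm_eq_abs]
  apply norm_integral_le_of_norm_le integrableOn_rfun_density
  rw [ae_restrict_iff' measurableSet_Ioi]
  filter_upwards with u hu
  have hu : 0 < u := hu
  rw [Real.norm_of_nonneg (by positivity)]
  apply mul_le_of_le_one_right (by positivity)
  rw [Real.exp_le_one_iff]
  nlinarith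

lemma continuousOn_rfun : ContinuousOn rfun (Ioi 0) := by
  unfold rfun
  apply ContinuousOn.mul continuousOn_const
  apply continuousOn_of_dominated (bound := fun u : ℝ => (u / (1 + u ^ 2)) * Real.exp (-etaF u))
  · intro x hx
    apply Continuous.aestronglyMeasurable
    exact ((Continuous.div (by fun_prop) (by fun_prop) (fun x => by positivity)).mul
      (Real.continuous_exp.comp continuous_etaF.neg)).mul (by fun_prop)
  · intro x hx
    rw [ae_restrict_iff' measurableSet_Ioi]
    filter_upwards with u hu
    have hu : 0 < u := hu
    have hx : 0 < x := hx
    rw [Real.norm_of_nonneg (by positivity)]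
    apply mul_le_of_le_one_right (by positivity)
    rw [Real.exp_le_one_iff]
    nlinarith
  · exact integrableOn_rfun_density
  · filter_upwards with u
    fun_prop

lemma psiOne_bounded : ∃ M : ℝ, 0 < M ∧ ∀ x, |psiOne x| ≤ M := by
  obtain ⟨M, hM⟩ := rfun_bounded
  have hM0 : 0 ≤ M := (abs_nonneg _).trans (hM 1 one_pos)
  refine ⟨1 + M, by linarith, fun x => ?_⟩
  unfold psiOne
  split_ifs with h
  · refine (abs_sub _ _).trans (add_le_add (Real.abs_sin_le_one _) (hM x h))
  · simp; linarith

lemma continuousOn_psiOne : ContinuousOn psiOne (Ioi 0) := by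
  have h : ContinuousOn (fun x => Real.sin (x + π / 8) - rfun x) (Ioi 0) :=
    ContinuousOn.sub (by fun_prop) continuousOn_rfun
  refine h.congr (fun x hx => ?_)
  simp only [psiOne, if_pos (show 0 < x from hx)]

lemma measurable_psiOne : Measurable psiOne := by
  have h : psiOne = (Ioi 0).indicator psiOne := by
    funext x
    by_cases hx : x ∈ Ioi (0 : ℝ)
    · rw [indicator_of_mem hx]
    · rw [indicator_of_notMem hx, psiOne, if_neg (by simpa using hx)]
  rw [h]
  have h2 : Measurable ((Ioi 0).piecewise psiOne (fun _ => (0 : ℝ))) :=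
    continuousOn_psiOne.measurable_piecewise continuousOn_const measurableSet_Ioi
  have h3 : (Ioi 0).indicator psiOne = (Ioi 0).piecewise psiOne (fun _ => (0 : ℝ)) := by
    funext x
    simp [indicator, piecewise]
  rw [h3]
  exact h2

lemma laplace_sin_add {z : ℝ} (hz : 0 < z) (θ : ℝ) :
    IntegrableOn (fun x => Real.sin (x + θ) * Real.exp (-(z * x))) (Ioi 0) ∧
    ∫ x in Ioi (0 : ℝ), Real.sin (x + θ) * Real.exp (-(z * x)) =
      (Real.cos θ + z * Real.sin θ) / (1 + z ^ 2) := by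
  have hexp : IntegrableOn (fun x => Real.exp (-(z * x))) (Ioi 0) := by
    have := integrableOn_exp_mul_Ioi (neg_neg_of_pos hz) 0
    simpa using this
  have h_int : IntegrableOn (fun x => Real.sin (x + θ) * Real.exp (-(z * x))) (Ioi 0) := by
    refine hexp.mono' (Continuous.aestronglyMeasurable (by fun_prop)) ?_
    filter_upwards with x
    rw [norm_mul, Real.norm_of_nonneg (Real.exp_pos _).le]
    exact mul_le_of_le_one_left (Real.exp_pos _).le (Real.abs_sin_le_one _)
  refine ⟨h_int, ?_⟩
  have hder : ∀ x : ℝ, HasDerivAt (fun x => -(Real.exp (-(z * x)) *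
      (z * Real.sin (x + θ) + Real.cos (x + θ))) / (1 + z ^ 2))
      (Real.sin (x + θ) * Real.exp (-(z * x))) x := by
    intro x
    have h1 : HasDerivAt (fun x => Real.exp (-(z * x))) (Real.exp (-(z * x)) * (-(z * 1))) x :=
      (((hasDerivAt_id x).const_mul z).neg).exp
    have h0 : HasDerivAt (fun x => x + θ) 1 x := (hasDerivAt_id x).add_const θ
    have h2 := (h0.sin.const_mul z).add h0.cos
    refine ((h1.mul h2).neg.div_const (1 + z ^ 2)).congr_deriv ?_
    simp only [Pi.add_apply]
    field_simp
    ring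
  have hlim : Filter.Tendsto (fun x => -(Real.exp (-(z * x)) *
      (z * Real.sin (x + θ) + Real.cos (x + θ))) / (1 + z ^ 2)) Filter.atTop (nhds 0) := by
    have h3 : Filter.Tendsto (fun x => Real.exp (-(z * x))) Filter.atTop (nhds 0) :=
      Real.tendsto_exp_neg_atTop_nhds_zero.comp (Filter.tendsto_id.const_mul_atTop hz)
    have h4 : Filter.Tendsto (fun x => Real.exp (-(z * x)) * (z + 1)) Filter.atTop (nhds 0) := by
      simpa using h3.mul_const (z + 1)
    apply squeeze_zero_norm _ h4
    intro x
    rw [norm_div, norm_neg, norm_mul, Real.norm_of_nonneg (Real.exp_pos _).le,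
      Real.norm_of_nonneg (by positivity : 0 ≤ 1 + z ^ 2)]
    apply (div_le_self (by positivity) (by nlinarith)).trans
    gcongr
    refine (norm_add_le _ _).trans (add_le_add ?_ (Real.abs_cos_le_one _))
    rw [norm_mul, Real.norm_of_nonneg hz.le]
    exact mul_le_of_le_one_right hz.le (Real.abs_sin_le_one _)
  rw [integral_Ioi_of_hasDerivAt_of_tendsto' (fun x _ => hder x) h_int hlim]
  simp
  ring

lemma integral_exp_neg_mul_Ioi {k : ℝ} (hk : 0 < k) :
    ∫ x in Ioi (0 : ℝ), Real.exp (-(k * x)) = 1 / k := by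
  have := integral_exp_mul_Ioi (neg_neg_of_pos hk) 0
  simp only [neg_mul, mul_zero, Real.exp_zero] at this
  rw [this]; field_simp

lemma integrableOn_exp_neg_mul {k : ℝ} (hk : 0 < k) :
    IntegrableOn (fun x => Real.exp (-(k * x))) (Ioi 0) := by
  have := integrableOn_exp_mul_Ioi (neg_neg_of_pos hk) 0
  simpa using this

lemma laplace_rfun {z : ℝ} (hz : 0 < z) :
    ∫ x in Ioi (0 : ℝ), rfun x * Real.exp (-(z * x)) =
      √2 / (2 * π) * ∫ u in Ioi (0 : ℝ), (u / (1 + u ^ 2)) * Real.exp (-etaF u) / (z + u) := by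
  unfold rfun
  simp_rw [mul_assoc (√2 / (2 * π))]
  rw [integral_const_mul]
  congr 1
  simp_rw [← integral_mul_const]
  rw [integral_integral_swap]
  · apply setIntegral_congr_fun measurableSet_Ioi
    intro u hu
    have hu : 0 < u := hu
    show ∫ x in Ioi (0 : ℝ), u / (1 + u ^ 2) * Real.exp (-etaF u) * Real.exp (-u * x) *
      Real.exp (-(z * x)) = _
    have h1 : ∀ x : ℝ, u / (1 + u ^ 2) * Real.exp (-etaF u) * Real.exp (-u * x) *
        Real.exp (-(z * x)) = u / (1 + u ^ 2) * Real.exp (-etaF u) * Real.exp (-((z + u) * x)) := by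
      intro x
      rw [mul_assoc _ (Real.exp (-u * x)), ← Real.exp_add]; ring_nf
    simp_rw [h1]
    rw [integral_const_mul, integral_exp_neg_mul_Ioi (by positivity)]
    ring
  · have h2 : Integrable (fun p : ℝ × ℝ => Real.exp (-(z * p.1)) *
        ((p.2 / (1 + p.2 ^ 2)) * Real.exp (-etaF p.2)))
        ((volume.restrict (Ioi 0)).prod (volume.restrict (Ioi 0))) :=
      Integrable.mul_prod (integrableOn_exp_neg_mul hz) integrableOn_rfun_density
    refine h2.mono' ?_ ?_
    · apply Continuous.aestronglyMeasurable
      apply Continuous.mul _ (by fun_prop)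
      apply Continuous.mul _ (by fun_prop)
      exact (Continuous.div (by fun_prop) (by fun_prop) (fun x => by positivity)).mul
        (Real.continuous_exp.comp (continuous_etaF.comp continuous_snd).neg)
    · rw [Measure.prod_restrict, ae_restrict_iff' (measurableSet_Ioi.prod measurableSet_Ioi)]
      filter_upwards with p hp
      have h3 : 0 < p.1 := hp.1
      have h4 : 0 < p.2 := hp.2
      simp only [Function.uncurry]
      rw [Real.norm_of_nonneg (by positivity), mul_comm (Real.exp (-(z * p.1)))]
      apply mul_le_mul_of_nonneg_right _ (by positivity)
      apply mul_le_of_le_one_right (by positivity)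
      rw [Real.exp_le_one_iff]
      nlinarith

lemma integrableOn_psiOne_mul_exp {a : ℝ} (ha : 0 < a) (l : ℝ) :
    IntegrableOn (fun x => psiOne (l * x) * Real.exp (-(a * x))) (Ioi 0) := by
  obtain ⟨M, hM, hb⟩ := psiOne_bounded
  refine ((integrableOn_exp_neg_mul ha).const_mul M).mono' ?_ ?_
  · apply Measurable.aestronglyMeasurable
    exact (measurable_psiOne.comp (by fun_prop)).mul (by fun_prop)
  · filter_upwards with x
    rw [norm_mul, Real.norm_of_nonneg (Real.exp_pos _).le]
    exact mul_le_mul_of_nonneg_right (hb _) (Real.exp_pos _).le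

lemma laplace_psiOne {z : ℝ} (hz : 0 < z) :
    ∫ x in Ioi (0 : ℝ), psiOne x * Real.exp (-(z * x)) =
      Real.exp (etaF z) / (√2 * (1 + z ^ 2)) := by
  have hs := laplace_sin_add hz (π / 8)
  have hp := integrableOn_psiOne_mul_exp hz 1
  simp only [one_mul] at hp
  have hr : IntegrableOn (fun x => rfun x * Real.exp (-(z * x))) (Ioi 0) := by
    refine (hs.1.sub hp).congr_fun (fun x hx => ?_) measurableSet_Ioi
    simp only [Pi.sub_apply, psiOne, if_pos (show 0 < x from hx)]
    ring
  have h1 : ∫ x in Ioi (0 : ℝ), psiOne x * Real.exp (-(z * x)) =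
      ∫ x in Ioi (0 : ℝ), (Real.sin (x + π / 8) * Real.exp (-(z * x)) -
        rfun x * Real.exp (-(z * x))) := by
    apply setIntegral_congr_fun measurableSet_Ioi
    intro x hx
    simp only [psiOne, if_pos (show 0 < x from hx)]
    ring
  rw [h1, integral_sub hs.1 hr, hs.2, laplace_rfun hz]
  have h2 := (integral_remainder_div hz).2
  have h3 : ∀ u : ℝ, -(1 / π * (u / ((1 + u ^ 2) * Real.exp (etaF u)))) / (z + u) =
      -(1 / π) * (u / (1 + u ^ 2) * Real.exp (-etaF u) / (z + u)) := by
    intro u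
    rw [Real.exp_neg]
    field_simp
  simp_rw [h3] at h2
  rw [integral_const_mul] at h2
  set I := ∫ u in Ioi (0 : ℝ), u / (1 + u ^ 2) * Real.exp (-etaF u) / (z + u)
  have hpi := Real.pi_pos.ne'
  have h4 : I = -π * ((Real.exp (etaF z) - √2 * (Real.cos (π / 8) + z * Real.sin (π / 8))) /
      (1 + z ^ 2)) := by
    rw [← h2]; field_simp
  rw [h4]
  have h5 : (√2) ^ 2 = 2 := Real.sq_sqrt (by norm_num)
  have h6 : √2 ≠ 0 := by positivity
  field_simp
  linear_combination (Real.exp (etaF z) - √2 * (Real.cos (π / 8) + z * Real.sin (π / 8))) * h5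

/-- The spectral side of the heat kernel identity. -/
noncomputable def heatSpectral (t x y : ℝ) : ℝ :=
  (2 / π) * ∫ l in Ioi (0 : ℝ), psiOne (l * x) * psiOne (l * y) * Real.exp (-l * t)

/-- The Laplace transform of `x ↦ psiOne (l * x)` at `a`. -/
noncomputable def psiLaplace (a l : ℝ) : ℝ :=
  1 / l * (Real.exp (etaF (a / l)) / (√2 * (1 + (a / l) ^ 2)))

lemma psiLaplace_pos {a l : ℝ} (hl : 0 < l) : 0 < psiLaplace a l := by
  unfold psiLaplace; positivity

lemma measurable_psiLaplace (a : ℝ) : Measurable (psiLaplace a) := by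
  have := continuous_etaF.measurable
  unfold psiLaplace
  fun_prop

lemma laplace_psiOne_mul {a l : ℝ} (ha : 0 < a) (hl : 0 < l) :
    ∫ x in Ioi (0 : ℝ), psiOne (l * x) * Real.exp (-(a * x)) = psiLaplace a l := by
  have h := integral_comp_mul_left_Ioi (fun x => psiOne x * Real.exp (-(a / l * x))) 0 hl
  rw [mul_zero, laplace_psiOne (by positivity)] at h
  rw [psiLaplace, one_div, ← smul_eq_mul, ← h]
  congr 1
  ext x
  congr 3
  field_simp

lemma integrable_spectral_triple {t a b : ℝ} (ht : 0 < t) (ha : 0 < a) (hb : 0 < b) :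
    Integrable (fun p : ℝ × ℝ × ℝ => psiOne (p.1 * p.2.1) * psiOne (p.1 * p.2.2) *
      Real.exp (-p.1 * t) * Real.exp (-(a * p.2.1 + b * p.2.2)))
      ((volume.restrict (Ioi 0)).prod
        ((volume.restrict (Ioi 0)).prod (volume.restrict (Ioi 0)))) := by
  obtain ⟨M, hM, hb'⟩ := psiOne_bounded
  have h := ((integrableOn_exp_neg_mul ht).const_mul (M * M)).mul_prod
    ((integrableOn_exp_neg_mul ha).mul_prod (integrableOn_exp_neg_mul hb))
  refine h.mono' ?_ ?_
  · have := measurable_psiOne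
    apply Measurable.aestronglyMeasurable
    fun_prop
  · filter_upwards with p
    rw [norm_mul, norm_mul, norm_mul, Real.norm_of_nonneg (Real.exp_pos _).le,
      Real.norm_of_nonneg (Real.exp_pos _).le, neg_add, Real.exp_add]
    rw [show -p.1 * t = -(t * p.1) by ring]
    gcongr
    · exact hb' _
    · exact hb' _

lemma laplace_heatSpectral {t a b : ℝ} (ht : 0 < t) (ha : 0 < a) (hb : 0 < b) :
    ∫ p, heatSpectral t p.1 p.2 * Real.exp (-(a * p.1 + b * p.2))
      ∂((volume.restrict (Ioi 0)).prod (volume.restrict (Ioi 0))) =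
    (2 / π) * ∫ l in Ioi (0 : ℝ), psiLaplace a l * psiLaplace b l * Real.exp (-(t * l)) := by
  have h := integral_integral_swap (f := fun (l : ℝ) (p : ℝ × ℝ) => psiOne (l * p.1) *
    psiOne (l * p.2) * Real.exp (-l * t) * Real.exp (-(a * p.1 + b * p.2)))
    (integrable_spectral_triple ht ha hb)
  unfold heatSpectral
  simp_rw [mul_assoc (2 / π)]
  rw [integral_const_mul]
  congr 1
  simp_rw [← integral_mul_const]
  rw [← h]
  apply setIntegral_congr_fun measurableSet_Ioi
  intro l hl
  have hl : 0 < l := hl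
  simp only
  rw [← laplace_psiOne_mul ha hl, ← laplace_psiOne_mul hb hl, ← integral_prod_mul,
    ← integral_mul_const]
  congr 1
  ext p
  rw [neg_add, Real.exp_add, show -l * t = -(t * l) by ring]
  ring

lemma measurable_heatSpectral : Measurable (fun p : ℝ × ℝ × ℝ => heatSpectral p.1 p.2.1 p.2.2) := by
  unfold heatSpectral
  apply Measurable.const_mul
  apply StronglyMeasurable.measurable
  have := measurable_psiOne
  apply StronglyMeasurable.integral_prod_right
    (f := fun (p : ℝ × ℝ × ℝ) l => psiOne (l * p.2.1) * psiOne (l * p.2.2) * Real.exp (-l * p.1))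
  apply Measurable.stronglyMeasurable
  fun_prop

lemma heatSpectral_bounded {t : ℝ} (ht : 0 < t) : ∃ C : ℝ, ∀ x y, |heatSpectral t x y| ≤ C := by
  obtain ⟨M, hM, hb⟩ := psiOne_bounded
  refine ⟨(2 / π) * ∫ l in Ioi (0 : ℝ), M * M * Real.exp (-(t * l)), fun x y => ?_⟩
  rw [heatSpectral, abs_mul, abs_of_pos (by positivity : 0 < 2 / π)]
  apply mul_le_mul_of_nonneg_left _ (by positivity)
  rw [← Real.norm_eq_abs]
  apply norm_integral_le_of_norm_le ((integrableOn_exp_neg_mul ht).const_mul _)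
  filter_upwards with l
  rw [norm_mul, norm_mul, Real.norm_of_nonneg (Real.exp_pos _).le,
    show -l * t = -(t * l) by ring]
  gcongr
  · exact hb _
  · exact hb _

lemma integrable_heatSpectral {t a b : ℝ} (ht : 0 < t) (ha : 0 < a) (hb : 0 < b) :
    Integrable (fun p : ℝ × ℝ => heatSpectral t p.1 p.2 * Real.exp (-(a * p.1 + b * p.2)))
      ((volume.restrict (Ioi 0)).prod (volume.restrict (Ioi 0))) := by
  obtain ⟨C, hC⟩ := heatSpectral_bounded ht
  have h := ((integrableOn_exp_neg_mul ha).const_mul C).mul_prod (integrableOn_exp_neg_mul hb)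
  refine h.mono' ?_ ?_
  · have h2 : Measurable (fun p : ℝ × ℝ => heatSpectral t p.1 p.2) :=
      measurable_heatSpectral.comp (g := fun p : ℝ × ℝ × ℝ => heatSpectral p.1 p.2.1 p.2.2)
        (f := fun p : ℝ × ℝ => (t, p)) (by fun_prop)
    apply Measurable.aestronglyMeasurable
    fun_prop
  · filter_upwards with p
    rw [norm_mul, Real.norm_of_nonneg (Real.exp_pos _).le, neg_add, Real.exp_add, ← mul_assoc]
    gcongr
    exact hC _ _

lemma integral_psiLaplace {a b q : ℝ} (ha : 0 < a) (hb : 0 < b) (hq : 0 < q) :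
    IntegrableOn (fun l => psiLaplace a l * psiLaplace b l / (q + l)) (Ioi 0) ∧
    (2 / π) * ∫ l in Ioi (0 : ℝ), psiLaplace a l * psiLaplace b l / (q + l) =
      1 / (q * (a + b) * Real.exp (etaF (a / q)) * Real.exp (etaF (b / q))) := by
  obtain ⟨h1, h2⟩ := integral_kernel_div ha hb (one_div_pos.mpr hq)
  have key : ∀ u ∈ Ioi (0 : ℝ), (|(-1 : ℝ)| * u ^ ((-1 : ℝ) - 1)) •
      (fun l => psiLaplace a l * psiLaplace b l / (q + l)) (u ^ (-1 : ℝ)) =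
      (π / (2 * q * (a + b))) * (1/π*((a+b)*u*exp (etaF (a*u))*exp (etaF (b*u))/
        ((1+(a*u)^2)*(1+(b*u)^2)))/(1/q+u)) := by
    intro u hu
    have hu : 0 < u := hu
    have h3 : √2 * √2 = 2 := Real.mul_self_sqrt (by norm_num)
    rw [show ((-1 : ℝ) - 1) = -2 by norm_num, Real.rpow_neg hu.le, Real.rpow_two,
      Real.rpow_neg_one]
    simp only [psiLaplace, div_inv_eq_mul, smul_eq_mul, abs_neg, abs_one, one_mul]
    have h4 : √2 ≠ 0 := by positivity
    have h5 : √2 ^ 2 = 2 := by rw [sq, h3]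
    field_simp
    rw [h5]
    ring
  constructor
  · rw [← integrableOn_Ioi_comp_rpow_iff _ (by norm_num : (-1 : ℝ) ≠ 0)]
    exact IntegrableOn.congr_fun (h1.const_mul (π / (2 * q * (a + b))))
      (fun u hu => (key u hu).symm) measurableSet_Ioi
  · rw [← integral_comp_rpow_Ioi _ (by norm_num : (-1 : ℝ) ≠ 0),
      setIntegral_congr_fun measurableSet_Ioi key, integral_const_mul, h2,
      mul_one_div, mul_one_div]
    field_simp

lemma integrable_psiLaplace_prod {a b q : ℝ} (ha : 0 < a) (hb : 0 < b) (hq : 0 < q) :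
    Integrable (fun p : ℝ × ℝ => psiLaplace a p.2 * psiLaplace b p.2 *
      Real.exp (-(p.1 * p.2)) * Real.exp (-(q * p.1)))
      ((volume.restrict (Ioi 0)).prod (volume.restrict (Ioi 0))) := by
  have hma := measurable_psiLaplace a
  have hmb := measurable_psiLaplace b
  have he : ∀ l t : ℝ, psiLaplace a l * psiLaplace b l *
      Real.exp (-(t * l)) * Real.exp (-(q * t)) =
      psiLaplace a l * psiLaplace b l * Real.exp (-((q + l) * t)) := by
    intro l t
    rw [mul_assoc _ (Real.exp _), ← Real.exp_add]; ring_nf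
  rw [integrable_prod_iff' (Measurable.aestronglyMeasurable (by fun_prop))]
  constructor
  · rw [ae_restrict_iff' measurableSet_Ioi]
    filter_upwards with l hl
    have hl : 0 < l := hl
    simp only [he]
    exact (integrableOn_exp_neg_mul (by positivity)).const_mul _
  · refine (integral_psiLaplace ha hb hq).1.congr_fun (fun l hl => ?_) measurableSet_Ioi
    have hl : 0 < l := hl
    have := psiLaplace_pos (a := a) hl
    have := psiLaplace_pos (a := b) hl
    have h6 : ∀ t : ℝ, ‖psiLaplace a l * psiLaplace b l * Real.exp (-((q + l) * t))‖ =
      psiLaplace a l * psiLaplace b l * Real.exp (-((q + l) * t)) := fun t => by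
        rw [Real.norm_of_nonneg (by positivity)]
    simp only [he, h6]
    rw [integral_const_mul, integral_exp_neg_mul_Ioi (by positivity), mul_one_div]

lemma laplace_time_psiLaplace {a b q : ℝ} (ha : 0 < a) (hb : 0 < b) (hq : 0 < q) :
    IntegrableOn (fun t => ((2 / π) * ∫ l in Ioi (0 : ℝ), psiLaplace a l * psiLaplace b l *
      Real.exp (-(t * l))) * Real.exp (-(q * t))) (Ioi 0) ∧
    ∫ t in Ioi (0 : ℝ), ((2 / π) * ∫ l in Ioi (0 : ℝ), psiLaplace a l * psiLaplace b l *
      Real.exp (-(t * l))) * Real.exp (-(q * t)) =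
      1 / (q * (a + b) * Real.exp (etaF (a / q)) * Real.exp (etaF (b / q))) := by
  have h := integrable_psiLaplace_prod ha hb hq
  have h1 := h.integral_prod_left
  simp only [integral_mul_const] at h1
  constructor
  · simp only [mul_assoc (2 / π)]
    exact h1.const_mul _
  · rw [← (integral_psiLaplace ha hb hq).2]
    simp only [mul_assoc (2 / π)]
    rw [integral_const_mul]
    congr 1
    simp only [← integral_mul_const]
    rw [integral_integral_swap h]
    apply setIntegral_congr_fun measurableSet_Ioi
    intro l hl
    have hl : 0 < l := hl
    have he : ∀ t : ℝ, psiLaplace a l * psiLaplace b l *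
        Real.exp (-(t * l)) * Real.exp (-(q * t)) =
        psiLaplace a l * psiLaplace b l * Real.exp (-((q + l) * t)) := by
      intro t
      rw [mul_assoc _ (Real.exp _), ← Real.exp_add]; ring_nf
    simp only [he]
    rw [integral_const_mul, integral_exp_neg_mul_Ioi (by positivity), mul_one_div]

lemma lintegral_Ioi_comp_mul {x : ℝ} (hx : 0 < x) (g : ℝ → ENNReal) (hg : Measurable g) :
    ∫⁻ s in Ioi (0 : ℝ), g s = ENNReal.ofReal x * ∫⁻ u in Ioi (0 : ℝ), g (x * u) := by
  have h := lintegral_image_eq_lintegral_abs_deriv_mul (s := Ioi 0) (f := fun u => x * u)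
    (f' := fun _ => x) measurableSet_Ioi
    (fun u _ => by simpa using ((hasDerivAt_id u).const_mul x).hasDerivWithinAt)
    ((mul_right_injective₀ hx.ne').injOn) g
  have h2 : (fun u => x * u) '' Ioi 0 = Ioi 0 := by
    simpa using Set.image_mul_left_Ioi hx 0
  rw [h2] at h
  rw [h, abs_of_pos hx, lintegral_const_mul _ (by fun_prop)]

lemma lintegral_Ioi_comp_add (x : ℝ) (g : ℝ → ENNReal) :
    ∫⁻ s in Ioi x, g s = ∫⁻ r in Ioi (0 : ℝ), g (x + r) := by
  rw [← lintegral_indicator measurableSet_Ioi, ← lintegral_indicator measurableSet_Ioi,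
    ← lintegral_add_left_eq_self _ x]
  congr 1
  ext r
  simp [indicator]

/-- Tonelli for a convolution integral on the half-line. -/
lemma lintegral_Ioi_Ioc {F : ℝ → ℝ → ENNReal} (hF : Measurable (Function.uncurry F)) :
    ∫⁻ t in Ioi (0 : ℝ), ∫⁻ s in Ioc 0 t, F s (t - s) =
      ∫⁻ s in Ioi (0 : ℝ), ∫⁻ r in Ioi (0 : ℝ), F s r := by
  have h1 : ∀ t ∈ Ioi (0 : ℝ), ∫⁻ s in Ioc 0 t, F s (t - s) =
      ∫⁻ s in Ioi (0 : ℝ), {p : ℝ × ℝ | p.2 ≤ p.1}.indicator (fun p => F p.2 (p.1 - p.2)) (t, s) := by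
    intro t _
    rw [← lintegral_indicator measurableSet_Ioi, ← lintegral_indicator measurableSet_Ioc]
    congr 1
    ext s
    simp only [indicator, mem_Ioc, mem_Ioi, mem_ofPred_eq]
    split_ifs <;> simp_all
  have hF' : Measurable (fun p : ℝ × ℝ => F p.2 (p.1 - p.2)) :=
    hF.comp (f := fun p : ℝ × ℝ => (p.2, p.1 - p.2)) (by fun_prop)
  have hm : Measurable ({p : ℝ × ℝ | p.2 ≤ p.1}.indicator (fun p => F p.2 (p.1 - p.2))) :=
    hF'.indicator (measurableSet_le measurable_snd measurable_fst)
  rw [setLIntegral_congr_fun measurableSet_Ioi h1, lintegral_lintegral_swap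
    (f := fun t s => {p : ℝ × ℝ | p.2 ≤ p.1}.indicator (fun p => F p.2 (p.1 - p.2)) (t, s))
    hm.aemeasurable]
  apply setLIntegral_congr_fun measurableSet_Ioi
  intro s hs
  have hs : 0 < s := hs
  have h2 : ∫⁻ t in Ioi (0 : ℝ), {p : ℝ × ℝ | p.2 ≤ p.1}.indicator
      (fun p => F p.2 (p.1 - p.2)) (t, s) = ∫⁻ t in Ioi s, F s (t - s) := by
    rw [setLIntegral_congr (Ioi_ae_eq_Ici (a := s)), ← lintegral_indicator measurableSet_Ioi,
      ← lintegral_indicator measurableSet_Ici]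
    congr 1
    ext t
    simp only [indicator, mem_Ici, mem_Ioi, mem_ofPred_eq]
    split_ifs <;> first | rfl | (exfalso; linarith)
  simp only
  rw [h2, lintegral_Ioi_comp_add]
  simp

/-- Tonelli on a quadrant split along the diagonal. -/
lemma lintegral_quadrant_split {G : ℝ → ℝ → ENNReal} (hG : Measurable (Function.uncurry G)) :
    ∫⁻ x in Ioi (0 : ℝ), ∫⁻ y in Ioi (0 : ℝ), G x y =
      (∫⁻ s in Ioi (0 : ℝ), ∫⁻ r in Ioi (0 : ℝ), G (s + r) s) +
      ∫⁻ s in Ioi (0 : ℝ), ∫⁻ r in Ioi (0 : ℝ), G s (s + r) := by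
  have hF : Measurable (Function.uncurry (fun s r => G (s + r) s)) :=
    hG.comp (f := fun p : ℝ × ℝ => (p.1 + p.2, p.1)) (by fun_prop)
  have hF2 : Measurable (Function.uncurry (fun s r => G s (s + r))) :=
    hG.comp (f := fun p : ℝ × ℝ => (p.1, p.1 + p.2)) (by fun_prop)
  rw [← lintegral_Ioi_Ioc hF, ← lintegral_add_right]
  · apply setLIntegral_congr_fun measurableSet_Ioi
    intro x hx
    have hx : 0 < x := hx
    simp only
    have h : ∫⁻ y in Ioi (0 : ℝ), G x y = (∫⁻ y in Ioc 0 x, G x y) + ∫⁻ y in Ioi x, G x y := by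
      rw [← Ioc_union_Ioi_eq_Ioi hx.le, lintegral_union measurableSet_Ioi (by simp)]
    rw [h, lintegral_Ioi_comp_add x]
    simp
  · exact Measurable.lintegral_prod_right hF2

lemma lintegral_exp_neg_mul {k : ℝ} (hk : 0 < k) :
    ∫⁻ x in Ioi (0 : ℝ), ENNReal.ofReal (Real.exp (-(k * x))) = ENNReal.ofReal (1 / k) := by
  rw [← integral_exp_neg_mul_Ioi hk, ofReal_integral_eq_lintegral_ofReal
    (integrableOn_exp_neg_mul hk) (Filter.Eventually.of_forall fun x => (Real.exp_pos _).le)]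

lemma continuous_fexit : Continuous fexit := by
  unfold fexit
  exact (continuous_const.mul (Continuous.div (by fun_prop) (by fun_prop)
    (fun x => by positivity))).mul (Real.continuous_exp.comp continuous_etaF)

lemma fexit_nonneg {u : ℝ} (hu : 0 ≤ u) : 0 ≤ fexit u := by
  unfold fexit; positivity

lemma fexit_pos {u : ℝ} (hu : 0 < u) : 0 < fexit u := by
  unfold fexit; positivity

lemma lintegral_fexit_div {z : ℝ} (hz : 0 < z) :
    ∫⁻ u in Ioi (0 : ℝ), ENNReal.ofReal (fexit u / (z + u)) =
      ENNReal.ofReal (1 / Real.exp (etaF z)) := by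
  obtain ⟨h1, h2⟩ := integral_fexit_div hz
  rw [← h2, ofReal_integral_eq_lintegral_ofReal h1]
  rw [Filter.EventuallyLE, ae_restrict_iff' measurableSet_Ioi]
  filter_upwards with u hu
  have hu : 0 < u := hu
  exact div_nonneg (fexit_nonneg hu.le) (by positivity)

lemma lintegral_fexit_div_mul {a q : ℝ} (ha : 0 < a) (hq : 0 < q) :
    ∫⁻ u in Ioi (0 : ℝ), ENNReal.ofReal (fexit u / (a + q * u)) =
      ENNReal.ofReal (1 / (q * Real.exp (etaF (a / q)))) := by
  have h1 : ∀ u ∈ Ioi (0 : ℝ), ENNReal.ofReal (fexit u / (a + q * u)) =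
      ENNReal.ofReal (1 / q) * ENNReal.ofReal (fexit u / (a / q + u)) := by
    intro u hu
    have hu : 0 < u := hu
    rw [← ENNReal.ofReal_mul (by positivity)]
    congr 1
    field_simp
  have := continuous_fexit.measurable
  rw [setLIntegral_congr_fun measurableSet_Ioi h1, lintegral_const_mul _ (by fun_prop),
    lintegral_fexit_div (by positivity), ← ENNReal.ofReal_mul (by positivity)]
  congr 1
  field_simp

/-- The kernel in the exit term. -/
noncomputable def exitKer (u v : ℝ) : ℝ := fexit u * fexit v / (u + v)

/-- The exit term of the heat kernel. -/
noncomputable def heatExit (t x y : ℝ) : ℝ :=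
  (1 / (x * y)) * ∫ s in Ioc 0 t, exitKer (s / x) ((t - s) / y)

lemma measurable_exitKer : Measurable (Function.uncurry exitKer) := by
  have := continuous_fexit.measurable
  unfold exitKer Function.uncurry
  fun_prop

lemma exitKer_nonneg {u v : ℝ} (hu : 0 ≤ u) (hv : 0 ≤ v) : 0 ≤ exitKer u v :=
  div_nonneg (mul_nonneg (fexit_nonneg hu) (fexit_nonneg hv)) (by positivity)

lemma heatExit_nonneg {t x y : ℝ} (hx : 0 < x) (hy : 0 < y) : 0 ≤ heatExit t x y := by
  unfold heatExit
  refine mul_nonneg (by positivity) (setIntegral_nonneg measurableSet_Ioc fun s hs => ?_)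
  have := hs.1
  exact exitKer_nonneg (by positivity) (div_nonneg (by linarith [hs.2]) hy.le)

lemma measurable_heatExit : Measurable (fun p : ℝ × ℝ × ℝ => heatExit p.1 p.2.1 p.2.2) := by
  have h : ∀ p : ℝ × ℝ × ℝ, heatExit p.1 p.2.1 p.2.2 = (1 / (p.2.1 * p.2.2)) *
      ∫ s, {w : (ℝ × ℝ × ℝ) × ℝ | 0 < w.2 ∧ w.2 ≤ w.1.1}.indicator
        (fun w => exitKer (w.2 / w.1.2.1) ((w.1.1 - w.2) / w.1.2.2)) (p, s) := by
    intro p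
    rw [heatExit, ← integral_indicator measurableSet_Ioc]
    rfl
  simp_rw [h]
  refine Measurable.mul (by fun_prop) ?_
  apply StronglyMeasurable.measurable
  apply StronglyMeasurable.integral_prod_right'
  apply Measurable.stronglyMeasurable
  refine Measurable.indicator ?_ ?_
  · exact measurable_exitKer.comp (f := fun w : (ℝ × ℝ × ℝ) × ℝ =>
      (w.2 / w.1.2.1, (w.1.1 - w.2) / w.1.2.2)) (by fun_prop)
  · exact (measurableSet_lt measurable_const measurable_snd).inter
      (measurableSet_le measurable_snd (by fun_prop))

lemma continuousOn_exitKer_slice {t x y : ℝ} (ht : 0 < t) (hx : 0 < x) (hy : 0 < y) :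
    ContinuousOn (fun s => exitKer (s / x) ((t - s) / y)) (Icc 0 t) := by
  have hf := continuous_fexit
  unfold exitKer
  refine ContinuousOn.div (by fun_prop) (by fun_prop) fun s hs => ?_
  rcases hs.1.eq_or_lt with h | h
  · rw [← h]; positivity
  · have h1 : 0 < s / x := by positivity
    have h2 : 0 ≤ (t - s) / y := div_nonneg (by linarith [hs.2]) hy.le
    positivity

lemma lintegral_time_heatExit {x y q : ℝ} (hx : 0 < x) (hy : 0 < y) :
    ∫⁻ t in Ioi (0 : ℝ), ENNReal.ofReal (heatExit t x y * Real.exp (-(q * t))) =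
      ∫⁻ u in Ioi (0 : ℝ), ∫⁻ v in Ioi (0 : ℝ),
        ENNReal.ofReal (exitKer u v * Real.exp (-(q * (x * u + y * v)))) := by
  have hm := measurable_exitKer
  set F : ℝ → ℝ → ENNReal := fun s r =>
    ENNReal.ofReal (exitKer (s / x) (r / y) * Real.exp (-(q * (s + r)))) with hFdef
  have hF : Measurable (Function.uncurry F) := by
    have h2 : Measurable fun p : ℝ × ℝ => exitKer (p.1 / x) (p.2 / y) :=
      hm.comp (f := fun p : ℝ × ℝ => (p.1 / x, p.2 / y)) (by fun_prop)
    apply ENNReal.measurable_ofReal.comp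
    fun_prop
  have h1 : ∀ t ∈ Ioi (0 : ℝ), ENNReal.ofReal (heatExit t x y * Real.exp (-(q * t))) =
      ENNReal.ofReal (1 / (x * y)) * ∫⁻ s in Ioc 0 t, F s (t - s) := by
    intro t ht
    have ht : 0 < t := ht
    have hi : IntegrableOn (fun s => exitKer (s / x) ((t - s) / y) * Real.exp (-(q * t)))
        (Ioc 0 t) :=
      (((continuousOn_exitKer_slice ht hx hy).integrableOn_Icc).mono_set
        Ioc_subset_Icc_self).mul_const _
    rw [heatExit, mul_assoc, ENNReal.ofReal_mul (by positivity), ← integral_mul_const,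
      ofReal_integral_eq_lintegral_ofReal hi]
    · congr 1
      apply setLIntegral_congr_fun measurableSet_Ioc
      intro s _
      simp [hFdef]
    · rw [Filter.EventuallyLE, ae_restrict_iff' measurableSet_Ioc]
      filter_upwards with s hs
      have := hs.1
      have h3 : 0 ≤ exitKer (s / x) ((t - s) / y) :=
        exitKer_nonneg (by positivity) (div_nonneg (by linarith [hs.2]) hy.le)
      simp only [Pi.zero_apply]
      positivity
  have hFi : Measurable fun s => ∫⁻ r in Ioi (0 : ℝ), F s r := hF.lintegral_prod_right'
  rw [setLIntegral_congr_fun measurableSet_Ioi h1, lintegral_const_mul', lintegral_Ioi_Ioc hF,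
    lintegral_Ioi_comp_mul hx _ hFi]
  · have h4 : ∀ u, ∫⁻ r in Ioi (0 : ℝ), F (x * u) r = ENNReal.ofReal y *
        ∫⁻ v in Ioi (0 : ℝ), ENNReal.ofReal (exitKer u v * Real.exp (-(q * (x * u + y * v)))) := by
      intro u
      rw [lintegral_Ioi_comp_mul hy (F (x * u)) hF.of_uncurry_left]
      congr 2
      ext v
      simp only [hFdef]
      rw [mul_div_cancel_left₀ _ hx.ne', mul_div_cancel_left₀ _ hy.ne']
    simp_rw [h4]
    rw [lintegral_const_mul', ← mul_assoc, ← mul_assoc, ← ENNReal.ofReal_mul (by positivity),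
      ← ENNReal.ofReal_mul (by positivity)]
    · have : 1 / (x * y) * x * y = 1 := by field_simp
      rw [this]; simp
    · simp
  · simp

lemma laplace_heatExit {a b q : ℝ} (ha : 0 < a) (hb : 0 < b) (hq : 0 < q) :
    ∫⁻ p, ENNReal.ofReal (heatExit p.1 p.2.1 p.2.2 * Real.exp (-(a * p.2.1 + b * p.2.2)) *
      Real.exp (-(q * p.1))) ∂((volume.restrict (Ioi 0)).prod
        ((volume.restrict (Ioi 0)).prod (volume.restrict (Ioi 0)))) =
    ∫⁻ u in Ioi (0 : ℝ), ∫⁻ v in Ioi (0 : ℝ),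
      ENNReal.ofReal (exitKer u v / ((a + q * u) * (b + q * v))) := by
  have hm := measurable_exitKer
  have hm' : Measurable fun p : ℝ × ℝ => exitKer p.1 p.2 := hm
  have hJ := measurable_heatExit
  rw [lintegral_prod_symm' _ (by fun_prop)]
  have h1 : ∀ᵐ w ∂((volume.restrict (Ioi (0 : ℝ))).prod (volume.restrict (Ioi (0 : ℝ)))),
      ∫⁻ t in Ioi (0 : ℝ), ENNReal.ofReal (heatExit t w.1 w.2 *
        Real.exp (-(a * w.1 + b * w.2)) * Real.exp (-(q * t))) =
      ∫⁻ z, ENNReal.ofReal (exitKer z.1 z.2 * (Real.exp (-((a + q * z.1) * w.1)) *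
        Real.exp (-((b + q * z.2) * w.2))))
        ∂((volume.restrict (Ioi (0 : ℝ))).prod (volume.restrict (Ioi (0 : ℝ)))) := by
    rw [Measure.prod_restrict, ae_restrict_iff' (measurableSet_Ioi.prod measurableSet_Ioi)]
    filter_upwards with w hw
    have hx : 0 < w.1 := hw.1
    have hy : 0 < w.2 := hw.2
    have h2 : ∀ t, ENNReal.ofReal (heatExit t w.1 w.2 *
        Real.exp (-(a * w.1 + b * w.2)) * Real.exp (-(q * t))) =
        ENNReal.ofReal (Real.exp (-(a * w.1 + b * w.2))) *
        ENNReal.ofReal (heatExit t w.1 w.2 * Real.exp (-(q * t))) := by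
      intro t
      rw [← ENNReal.ofReal_mul (by positivity)]
      congr 1; ring
    simp_rw [h2]
    rw [lintegral_const_mul' _ _ (by simp), lintegral_time_heatExit hx hy, ← Measure.prod_restrict,
      lintegral_lintegral, ← lintegral_const_mul' _ _ (by simp)]
    · congr 1
      ext z
      rw [← ENNReal.ofReal_mul (by positivity)]
      congr 1
      rw [mul_comm, mul_assoc, ← Real.exp_add, ← Real.exp_add]
      congr 2; ring
    · apply Measurable.aemeasurable
      unfold Function.uncurry
      fun_prop
  rw [lintegral_congr_ae h1, lintegral_lintegral_swap, lintegral_lintegral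
    (f := fun u v => ENNReal.ofReal (exitKer u v / ((a + q * u) * (b + q * v))))]
  · apply lintegral_congr_ae
    rw [Measure.prod_restrict, Filter.EventuallyEq,
      ae_restrict_iff' (measurableSet_Ioi.prod measurableSet_Ioi)]
    filter_upwards with z hz
    have hu : 0 < z.1 := hz.1
    have hv : 0 < z.2 := hz.2
    have hk := exitKer_nonneg hu.le hv.le
    have h3 : ∀ w : ℝ × ℝ, ENNReal.ofReal (exitKer z.1 z.2 * (Real.exp (-((a + q * z.1) * w.1)) *
        Real.exp (-((b + q * z.2) * w.2)))) = ENNReal.ofReal (exitKer z.1 z.2) *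
        (ENNReal.ofReal (Real.exp (-((a + q * z.1) * w.1))) *
          ENNReal.ofReal (Real.exp (-((b + q * z.2) * w.2)))) := by
      intro w
      rw [ENNReal.ofReal_mul hk, ENNReal.ofReal_mul (by positivity)]
    simp_rw [h3]
    rw [← Measure.prod_restrict, lintegral_const_mul' _ _ (by simp),
      lintegral_prod_mul (f := fun x => ENNReal.ofReal (Real.exp (-((a + q * z.1) * x))))
        (g := fun y => ENNReal.ofReal (Real.exp (-((b + q * z.2) * y))))
        (by fun_prop) (by fun_prop),
      lintegral_exp_neg_mul (by positivity), lintegral_exp_neg_mul (by positivity),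
      ← ENNReal.ofReal_mul (by positivity), ← ENNReal.ofReal_mul hk]
    congr 1
    field_simp
  · apply Measurable.aemeasurable
    unfold Function.uncurry
    fun_prop
  · apply Measurable.aemeasurable
    unfold Function.uncurry
    fun_prop

/-- The free Cauchy kernel. -/
noncomputable def heatFree (t x y : ℝ) : ℝ := (1 / π) * (t / (t ^ 2 + (x - y) ^ 2))

lemma measurable_heatFree : Measurable (fun p : ℝ × ℝ × ℝ => heatFree p.1 p.2.1 p.2.2) := by
  unfold heatFree
  fun_prop

lemma heatFree_nonneg {t : ℝ} (ht : 0 ≤ t) (x y : ℝ) : 0 ≤ heatFree t x y := by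
  unfold heatFree; positivity

/-- The half-plane Poisson kernel, Laplace transformed in both variables. -/
noncomputable def poissonLaplace (b q : ℝ) : ENNReal :=
  ∫⁻ v in Ioi (0 : ℝ), ENNReal.ofReal (1 / π * (v / (1 + v ^ 2)) / (b + q * v))

lemma lintegral_poisson {b q : ℝ} (hb : 0 < b) (hq : 0 < q) :
    ∫⁻ t in Ioi (0 : ℝ), ∫⁻ r in Ioi (0 : ℝ), ENNReal.ofReal
      (1 / π * (t / (t ^ 2 + r ^ 2)) * Real.exp (-(b * r)) * Real.exp (-(q * t))) =
      poissonLaplace b q := by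
  rw [lintegral_lintegral_swap]
  · have h1 : ∀ r ∈ Ioi (0 : ℝ), ∫⁻ t in Ioi (0 : ℝ), ENNReal.ofReal
        (1 / π * (t / (t ^ 2 + r ^ 2)) * Real.exp (-(b * r)) * Real.exp (-(q * t))) =
        ∫⁻ v in Ioi (0 : ℝ), ENNReal.ofReal (1 / π * (v / (1 + v ^ 2)) *
          Real.exp (-((b + q * v) * r))) := by
      intro r hr
      have hr : 0 < r := hr
      rw [lintegral_Ioi_comp_mul hr _ (by fun_prop), ← lintegral_const_mul' _ _ (by simp)]
      congr 1
      ext v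
      rw [← ENNReal.ofReal_mul hr.le, mul_assoc _ (Real.exp _), ← Real.exp_add]
      congr 1
      rw [show -(b * r) + -(q * (r * v)) = -((b + q * v) * r) by ring]
      field_simp
      ring
    rw [setLIntegral_congr_fun measurableSet_Ioi h1, lintegral_lintegral_swap, poissonLaplace]
    · apply setLIntegral_congr_fun measurableSet_Ioi
      intro v hv
      have hv : 0 < v := hv
      have h2 : ∀ r, ENNReal.ofReal (1 / π * (v / (1 + v ^ 2)) *
          Real.exp (-((b + q * v) * r))) = ENNReal.ofReal (1 / π * (v / (1 + v ^ 2))) *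
          ENNReal.ofReal (Real.exp (-((b + q * v) * r))) := by
        intro r
        rw [ENNReal.ofReal_mul (by positivity)]
      simp only [h2]
      rw [lintegral_const_mul' _ _ (by simp), lintegral_exp_neg_mul (by positivity),
        ← ENNReal.ofReal_mul (by positivity), mul_one_div]
    · apply Measurable.aemeasurable
      unfold Function.uncurry
      fun_prop
  · apply Measurable.aemeasurable
    unfold Function.uncurry
    fun_prop

lemma laplace_heatFree {a b q : ℝ} (ha : 0 < a) (hb : 0 < b) (hq : 0 < q) :
    ∫⁻ p, ENNReal.ofReal (heatFree p.1 p.2.1 p.2.2 * Real.exp (-(a * p.2.1 + b * p.2.2)) *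
      Real.exp (-(q * p.1))) ∂((volume.restrict (Ioi 0)).prod
        ((volume.restrict (Ioi 0)).prod (volume.restrict (Ioi 0)))) =
    ENNReal.ofReal (1 / (a + b)) * (poissonLaplace a q + poissonLaplace b q) := by
  have hp := measurable_heatFree
  have hpm : ∀ b : ℝ, Measurable (Function.uncurry fun t r : ℝ => ENNReal.ofReal
      (1 / π * (t / (t ^ 2 + r ^ 2)) * Real.exp (-(b * r)) * Real.exp (-(q * t)))) := by
    intro b
    unfold Function.uncurry
    fun_prop
  rw [lintegral_prod _ (by fun_prop), ← lintegral_poisson ha hq, ← lintegral_poisson hb hq,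
    ← lintegral_add_left (Measurable.lintegral_prod_right (hpm a)), ← lintegral_const_mul' _ _ (by simp)]
  apply setLIntegral_congr_fun measurableSet_Ioi
  intro t ht
  have ht : 0 < t := ht
  have hpt : Measurable fun p : ℝ × ℝ => heatFree t p.1 p.2 :=
    hp.comp (f := fun p : ℝ × ℝ => (t, p)) (by fun_prop)
  have hE : ∀ r s : ℝ, ENNReal.ofReal (Real.exp (-((a + b) * s))) * ENNReal.ofReal (1 / π * (t / (t ^ 2 + r ^ 2)) * Real.exp (-(a * r)) *
      Real.exp (-(q * t))) = ENNReal.ofReal (heatFree t (s + r) s *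
        Real.exp (-(a * (s + r) + b * s)) * Real.exp (-(q * t))) := by
    intro r s
    rw [← ENNReal.ofReal_mul (by positivity), heatFree]
    congr 1
    rw [show -(a * (s + r) + b * s) = -((a + b) * s) + -(a * r) by ring, Real.exp_add]
    ring_nf
  have hE2 : ∀ r s : ℝ, ENNReal.ofReal (Real.exp (-((a + b) * s))) * ENNReal.ofReal (1 / π * (t / (t ^ 2 + r ^ 2)) * Real.exp (-(b * r)) *
      Real.exp (-(q * t))) = ENNReal.ofReal (heatFree t s (s + r) *
        Real.exp (-(a * s + b * (s + r))) * Real.exp (-(q * t))) := by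
    intro r s
    rw [← ENNReal.ofReal_mul (by positivity), heatFree]
    congr 1
    rw [show -(a * s + b * (s + r)) = -((a + b) * s) + -(b * r) by ring, Real.exp_add]
    ring_nf
  simp only
  rw [lintegral_prod _ (by fun_prop), lintegral_quadrant_split, mul_add]
  · simp only [← hE, ← hE2]
    rw [lintegral_lintegral_mul (by fun_prop) (by fun_prop),
      lintegral_lintegral_mul (by fun_prop) (by fun_prop),
      lintegral_exp_neg_mul (by positivity)]
  · unfold Function.uncurry
    fun_prop

lemma poissonLaplace_eq {b q : ℝ} (hb : 0 < b) (hq : 0 < q) :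
    poissonLaplace b q = ∫⁻ v in Ioi (0 : ℝ), ∫⁻ u in Ioi (0 : ℝ),
      ENNReal.ofReal (exitKer u v / (b + q * v)) := by
  apply setLIntegral_congr_fun measurableSet_Ioi
  intro v hv
  have hv : 0 < v := hv
  have hf := fexit_pos hv
  have h1 : ∀ u, ENNReal.ofReal (exitKer u v / (b + q * v)) =
      ENNReal.ofReal (fexit v / (b + q * v)) * ENNReal.ofReal (fexit u / (v + u)) := by
    intro u
    rw [← ENNReal.ofReal_mul (by positivity), exitKer, add_comm v u]
    congr 1
    ring
  simp only [h1]
  rw [lintegral_const_mul' _ _ (by simp), lintegral_fexit_div hv,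
    ← ENNReal.ofReal_mul (by positivity), fexit]
  congr 1
  field_simp

lemma poissonLaplace_ne_top {b q : ℝ} (hb : 0 < b) (hq : 0 < q) : poissonLaplace b q ≠ ⊤ := by
  obtain ⟨c, C, hc, hC, hκ⟩ := exp_etaF_bounds
  have h1 : poissonLaplace b q ≤ ENNReal.ofReal (1 / c) * ∫⁻ u in Ioi (0 : ℝ),
      ENNReal.ofReal (fexit u / (b + q * u)) := by
    rw [← lintegral_const_mul' _ _ (by simp)]
    apply setLIntegral_mono' measurableSet_Ioi
    intro u hu
    have hu : 0 < u := hu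
    rw [← ENNReal.ofReal_mul (by positivity)]
    apply ENNReal.ofReal_le_ofReal
    rw [fexit]
    have h2 : 1 ≤ 1 / c * Real.exp (etaF u) := by
      rw [one_div, ← div_eq_inv_mul, le_div_iff₀ hc, one_mul]
      refine le_trans ?_ (hκ u hu).1
      exact le_mul_of_one_le_right hc.le (Real.one_le_sqrt.mpr (by linarith))
    calc 1 / π * (u / (1 + u ^ 2)) / (b + q * u) =
        1 * (1 / π * (u / (1 + u ^ 2)) / (b + q * u)) := by ring
      _ ≤ (1 / c * Real.exp (etaF u)) * (1 / π * (u / (1 + u ^ 2)) / (b + q * u)) := by gcongr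
      _ = _ := by ring
  rw [lintegral_fexit_div_mul hb hq] at h1
  exact ne_top_of_le_ne_top (by simp [ENNReal.mul_eq_top]) h1

lemma laplace_heatFree_eq {a b q : ℝ} (ha : 0 < a) (hb : 0 < b) (hq : 0 < q) :
    ENNReal.ofReal (1 / (a + b)) * (poissonLaplace a q + poissonLaplace b q) =
      (∫⁻ u in Ioi (0 : ℝ), ∫⁻ v in Ioi (0 : ℝ),
        ENNReal.ofReal (exitKer u v / ((a + q * u) * (b + q * v)))) +
      ENNReal.ofReal (1 / (q * (a + b) * Real.exp (etaF (a / q)) * Real.exp (etaF (b / q)))) := by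
  have hm : Measurable fun p : ℝ × ℝ => exitKer p.1 p.2 := measurable_exitKer
  have hfm := continuous_fexit.measurable
  have hmeas : ∀ g : ℝ × ℝ → ℝ, Measurable g →
      AEMeasurable (fun p : ℝ × ℝ => ENNReal.ofReal (exitKer p.1 p.2 / g p))
      ((volume.restrict (Ioi 0)).prod (volume.restrict (Ioi 0))) := fun g hg =>
    Measurable.aemeasurable (by fun_prop)
  have hsymm : ∀ u v, exitKer u v = exitKer v u := fun u v => by
    rw [exitKer, exitKer, mul_comm, add_comm]
  have h1 : poissonLaplace a q = ∫⁻ p, ENNReal.ofReal (exitKer p.1 p.2 / (a + q * p.1))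
      ∂((volume.restrict (Ioi 0)).prod (volume.restrict (Ioi 0))) := by
    rw [poissonLaplace_eq ha hq, lintegral_prod _ (hmeas _ (by fun_prop))]
    simp_rw [fun u v => hsymm v u]
  have h2 : poissonLaplace b q = ∫⁻ p, ENNReal.ofReal (exitKer p.1 p.2 / (b + q * p.2))
      ∂((volume.restrict (Ioi 0)).prod (volume.restrict (Ioi 0))) := by
    rw [poissonLaplace_eq hb hq, lintegral_prod_symm _ (hmeas _ (by fun_prop))]
  have h3 : ENNReal.ofReal (1 / (q * (a + b) * Real.exp (etaF (a / q)) *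
      Real.exp (etaF (b / q)))) = ENNReal.ofReal (q / (a + b)) *
      ∫⁻ p, ENNReal.ofReal (fexit p.1 / (a + q * p.1)) * ENNReal.ofReal (fexit p.2 / (b + q * p.2))
      ∂((volume.restrict (Ioi 0)).prod (volume.restrict (Ioi 0))) := by
    rw [lintegral_prod_mul (f := fun u => ENNReal.ofReal (fexit u / (a + q * u)))
      (g := fun u => ENNReal.ofReal (fexit u / (b + q * u))) (by fun_prop) (by fun_prop),
      lintegral_fexit_div_mul ha hq, lintegral_fexit_div_mul hb hq,
      ← ENNReal.ofReal_mul (by positivity), ← ENNReal.ofReal_mul (by positivity)]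
    congr 1
    field_simp
  rw [h1, h2, h3, ← lintegral_prod (fun p : ℝ × ℝ => ENNReal.ofReal
      (exitKer p.1 p.2 / ((a + q * p.1) * (b + q * p.2)))) (hmeas _ (by fun_prop)),
    ← lintegral_add_left' (hmeas _ (by fun_prop)), ← lintegral_const_mul' _ _ (by simp),
    ← lintegral_const_mul' _ _ (by simp), ← lintegral_add_left' (hmeas _ (by fun_prop))]
  apply lintegral_congr_ae
  rw [Measure.prod_restrict, Filter.EventuallyEq,
    ae_restrict_iff' (measurableSet_Ioi.prod measurableSet_Ioi)]
  filter_upwards with z hz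
  have hu : 0 < z.1 := hz.1
  have hv : 0 < z.2 := hz.2
  have hk := exitKer_nonneg hu.le hv.le
  have hfu := fexit_pos hu
  have hfv := fexit_pos hv
  rw [← ENNReal.ofReal_mul (by positivity), ← ENNReal.ofReal_mul (by positivity),
    ← ENNReal.ofReal_add (by positivity) (by positivity), ← ENNReal.ofReal_mul (by positivity),
    ← ENNReal.ofReal_add (by positivity) (by positivity)]
  congr 1
  rw [exitKer]
  field_simp
  ring

lemma integrable_heatFree_sub_heatExit {a b q : ℝ} (ha : 0 < a) (hb : 0 < b) (hq : 0 < q) :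
    Integrable (fun p : ℝ × ℝ × ℝ => (heatFree p.1 p.2.1 p.2.2 - heatExit p.1 p.2.1 p.2.2) *
      Real.exp (-(a * p.2.1 + b * p.2.2)) * Real.exp (-(q * p.1)))
      ((volume.restrict (Ioi 0)).prod
        ((volume.restrict (Ioi 0)).prod (volume.restrict (Ioi 0)))) ∧
    ∫ p, (heatFree p.1 p.2.1 p.2.2 - heatExit p.1 p.2.1 p.2.2) *
      Real.exp (-(a * p.2.1 + b * p.2.2)) * Real.exp (-(q * p.1))
      ∂((volume.restrict (Ioi 0)).prod
        ((volume.restrict (Ioi 0)).prod (volume.restrict (Ioi 0)))) =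
      1 / (q * (a + b) * Real.exp (etaF (a / q)) * Real.exp (etaF (b / q))) := by
  have hp := measurable_heatFree
  have hJ := measurable_heatExit
  set μ := ((volume.restrict (Ioi (0 : ℝ))).prod
        ((volume.restrict (Ioi (0 : ℝ))).prod (volume.restrict (Ioi (0 : ℝ))))) with hμ
  set P : ℝ × ℝ × ℝ → ℝ := fun p => heatFree p.1 p.2.1 p.2.2 *
    Real.exp (-(a * p.2.1 + b * p.2.2)) * Real.exp (-(q * p.1)) with hP
  set J : ℝ × ℝ × ℝ → ℝ := fun p => heatExit p.1 p.2.1 p.2.2 *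
    Real.exp (-(a * p.2.1 + b * p.2.2)) * Real.exp (-(q * p.1)) with hJd
  have hpos : ∀ᵐ p ∂μ, 0 ≤ P p ∧ 0 ≤ J p := by
    rw [hμ, Measure.prod_restrict, Measure.prod_restrict, ae_restrict_iff'
      (measurableSet_Ioi.prod (measurableSet_Ioi.prod measurableSet_Ioi))]
    filter_upwards with p hp
    have h1 : 0 < p.1 := hp.1
    have h2 := heatFree_nonneg h1.le p.2.1 p.2.2
    have h3 := heatExit_nonneg (t := p.1) hp.2.1 hp.2.2
    constructor <;> positivity
  have hP0 : 0 ≤ᵐ[μ] P := hpos.mono fun p h => h.1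
  have hJ0 : 0 ≤ᵐ[μ] J := hpos.mono fun p h => h.2
  have e1 : ∫⁻ p, ENNReal.ofReal (P p) ∂μ = _ := laplace_heatFree ha hb hq
  have e2 : ∫⁻ p, ENNReal.ofReal (J p) ∂μ = _ := laplace_heatExit ha hb hq
  have hPm : AEStronglyMeasurable P μ := by
    apply Measurable.aestronglyMeasurable
    fun_prop
  have hJm : AEStronglyMeasurable J μ := by
    apply Measurable.aestronglyMeasurable
    fun_prop
  have fin1 : ∫⁻ p, ENNReal.ofReal (P p) ∂μ ≠ ⊤ := by
    rw [e1]
    exact ENNReal.mul_ne_top (by simp)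
      (ENNReal.add_ne_top.mpr ⟨poissonLaplace_ne_top ha hq, poissonLaplace_ne_top hb hq⟩)
  rw [laplace_heatFree_eq ha hb hq, ← e2] at e1
  have fin2 : ∫⁻ p, ENNReal.ofReal (J p) ∂μ ≠ ⊤ := by
    rw [e1] at fin1
    exact (ENNReal.add_ne_top.mp fin1).1
  have iP : Integrable P μ := (lintegral_ofReal_ne_top_iff_integrable hPm hP0).mp fin1
  have iJ : Integrable J μ := (lintegral_ofReal_ne_top_iff_integrable hJm hJ0).mp fin2
  have hPJ : (fun p : ℝ × ℝ × ℝ => (heatFree p.1 p.2.1 p.2.2 - heatExit p.1 p.2.1 p.2.2) *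
      Real.exp (-(a * p.2.1 + b * p.2.2)) * Real.exp (-(q * p.1))) = fun p => P p - J p := by
    ext p
    simp only [hP, hJd]
    ring
  rw [hPJ]
  refine ⟨iP.sub iJ, ?_⟩
  rw [integral_sub iP iJ, integral_eq_lintegral_of_nonneg_ae hP0 hPm,
    integral_eq_lintegral_of_nonneg_ae hJ0 hJm, e1, ENNReal.toReal_add fin2 (by simp),
    ENNReal.toReal_ofReal (by positivity)]
  ring

/-- An integrable function on the half-line whose Laplace transform vanishes at the natural
numbers is zero almost everywhere. -/
lemma ae_eq_zero_of_laplace_nat {G : ℝ → ℝ} (hG : IntegrableOn G (Ioi 0))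
    (h : ∀ n : ℕ, ∫ t in Ioi (0 : ℝ), G t * Real.exp (-(n * t)) = 0) :
    ∀ᵐ t ∂(volume.restrict (Ioi (0 : ℝ))), G t = 0 := by
  have hbd : ∀ n : ℕ, IntegrableOn (fun t => G t * Real.exp (-(n * t))) (Ioi 0) := by
    intro n
    refine hG.norm.mono' (hG.aestronglyMeasurable.mul
      (Continuous.aestronglyMeasurable (by fun_prop))) ?_
    rw [ae_restrict_iff' measurableSet_Ioi]
    filter_upwards with t ht
    have ht : 0 < t := ht
    rw [norm_mul, Real.norm_of_nonneg (Real.exp_pos _).le]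
    refine mul_le_of_le_one_right (norm_nonneg _) (Real.exp_le_one_iff.mpr ?_)
    have : 0 ≤ (n : ℝ) * t := by positivity
    linarith
  have hpoly : ∀ p : Polynomial ℝ,
      IntegrableOn (fun t => G t * p.eval (Real.exp (-t))) (Ioi 0) ∧
      ∫ t in Ioi (0 : ℝ), G t * p.eval (Real.exp (-t)) = 0 := by
    intro p
    have h1 : ∀ t, G t * p.eval (Real.exp (-t)) =
        ∑ i ∈ Finset.range (p.natDegree + 1), p.coeff i * (G t * Real.exp (-(i * t))) := by
      intro t
      rw [Polynomial.eval_eq_sum_range, Finset.mul_sum]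
      refine Finset.sum_congr rfl fun i _ => ?_
      rw [← Real.exp_nat_mul]
      ring_nf
    simp only [h1]
    constructor
    · exact integrable_finsetSum _ fun i _ => (hbd i).const_mul _
    · rw [integral_finsetSum _ fun i _ => (hbd i).const_mul _]
      refine Finset.sum_eq_zero fun i _ => ?_
      rw [integral_const_mul, h, mul_zero]
  have key : ∀ g : ℝ → ℝ, ContDiff ℝ (↑(⊤ : ℕ∞)) g → HasCompactSupport g → tsupport g ⊆ Ioi 0 →
      ∫ t, g t • G t = 0 := by
    intro g hg hc hs
    have hφ : ContinuousOn (fun v => g (-Real.log v)) (Icc 0 1) := by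
      intro v hv
      rcases hv.1.eq_or_lt with h0 | h0
      · subst h0
        apply ContinuousAt.continuousWithinAt
        obtain ⟨R, hR⟩ := hc.isCompact.bddAbove
        have h2 : ∀ᶠ v in nhds (0 : ℝ), g (-Real.log v) = 0 := by
          have h3 : ∀ᶠ v in nhdsWithin (0 : ℝ) {0}ᶜ, Real.log v < -R :=
            Real.tendsto_log_nhdsNE_zero.eventually (Filter.eventually_lt_atBot _)
          rw [eventually_nhdsWithin_iff] at h3
          filter_upwards [h3] with v hv
          by_cases h4 : v = 0
          · subst h4
            simp only [Real.log_zero, neg_zero]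
            apply image_eq_zero_of_notMem_tsupport
            intro h5
            exact lt_irrefl (0 : ℝ) (hs h5)
          · apply image_eq_zero_of_notMem_tsupport
            intro h5
            have := hR h5
            have := hv h4
            linarith
        exact (continuousAt_const (y := (0 : ℝ))).congr (h2.mono fun v hv => hv.symm)
      · apply ContinuousAt.continuousWithinAt
        exact ContinuousAt.comp (g := g) hg.continuous.continuousAt
          (Real.continuousAt_log h0.ne').neg
    have h0 : ∀ t, t ∉ Ioi (0 : ℝ) → g t = 0 := fun t ht =>
      image_eq_zero_of_notMem_tsupport fun h5 => ht (hs h5)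
    have h1 : ∫ t, g t • G t = ∫ t in Ioi (0 : ℝ), G t * g t := by
      rw [← setIntegral_eq_integral_of_forall_compl_eq_zero (s := Ioi 0)]
      · simp [mul_comm]
      · intro t ht
        rw [h0 t ht, zero_smul]
    rw [h1]
    have hgi : IntegrableOn (fun t => G t * g t) (Ioi 0) := by
      obtain ⟨C, hC⟩ := hc.exists_bound_of_continuous hg.continuous
      exact hG.mul_bdd hg.continuous.aestronglyMeasurable (Filter.Eventually.of_forall hC)
    set N := ∫ t in Ioi (0 : ℝ), ‖G t‖ with hN
    have hN0 : 0 ≤ N := integral_nonneg fun t => norm_nonneg _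
    have hε : ∀ ε : ℝ, 0 < ε → |∫ t in Ioi (0 : ℝ), G t * g t| ≤ ε * N := by
      intro ε hε
      obtain ⟨p, hp⟩ := exists_polynomial_near_of_continuousOn 0 1 _ hφ ε hε
      obtain ⟨hp1, hp2⟩ := hpoly p
      have hd : ∫ t in Ioi (0 : ℝ), G t * g t =
          ∫ t in Ioi (0 : ℝ), (G t * g t - G t * p.eval (Real.exp (-t))) := by
        rw [integral_sub hgi hp1, hp2, sub_zero]
      rw [hd, ← Real.norm_eq_abs, hN, ← integral_const_mul]
      apply norm_integral_le_of_norm_le (hG.norm.const_mul ε)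
      rw [ae_restrict_iff' measurableSet_Ioi]
      filter_upwards with t ht
      have ht : 0 < t := ht
      rw [← mul_sub, norm_mul, mul_comm]
      apply mul_le_mul_of_nonneg_right _ (norm_nonneg _)
      have := hp (Real.exp (-t)) ⟨(Real.exp_pos _).le, Real.exp_le_one_iff.mpr (by linarith)⟩
      simp only [Real.log_exp, neg_neg] at this
      rw [Real.norm_eq_abs, abs_sub_comm]
      exact this.le
    by_contra hne
    have hpos : 0 < |∫ t in Ioi (0 : ℝ), G t * g t| := abs_pos.mpr hne
    have := hε (|∫ t in Ioi (0 : ℝ), G t * g t| / (2 * (N + 1))) (by positivity)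
    rw [div_mul_eq_mul_div, le_div_iff₀ (by positivity)] at this
    nlinarith
  rw [ae_restrict_iff' measurableSet_Ioi]
  exact isOpen_Ioi.ae_eq_zero_of_integral_contDiff_smul_eq_zero hG.locallyIntegrableOn key

lemma eq_zero_of_ae_eq_zero {G : ℝ → ℝ} {c x : ℝ} (hc : 0 ≤ c) (hx : c < x)
    (hG : ContinuousOn G (Ioi c)) (h : ∀ᵐ t ∂(volume.restrict (Ioi (0 : ℝ))), G t = 0) :
    G x = 0 := by
  have h1 : G =ᵐ[volume.restrict (Ioi c)] fun _ => 0 :=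
    ae_mono (Measure.restrict_mono_set _ (Ioi_subset_Ioi hc)) h
  exact Measure.eqOn_open_of_ae_eq h1 isOpen_Ioi hG continuousOn_const hx

/-- A two-variable version of `ae_eq_zero_of_laplace_nat` for separately continuous functions. -/
lemma eq_zero_of_laplace_nat_two {D : ℝ → ℝ → ℝ}
    (hx : ∀ y, 0 < y → ContinuousOn (fun x => D x y) (Ioi 0))
    (hy : ∀ x, 0 < x → ContinuousOn (fun y => D x y) (Ioi 0))
    (hD : ∀ m n : ℕ, Integrable (fun p : ℝ × ℝ => D p.1 p.2 *
      Real.exp (-(((m : ℝ) + 1) * p.1 + ((n : ℝ) + 1) * p.2)))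
      ((volume.restrict (Ioi 0)).prod (volume.restrict (Ioi 0))))
    (h : ∀ m n : ℕ, ∫ p : ℝ × ℝ, D p.1 p.2 *
      Real.exp (-(((m : ℝ) + 1) * p.1 + ((n : ℝ) + 1) * p.2))
      ∂((volume.restrict (Ioi 0)).prod (volume.restrict (Ioi 0))) = 0) :
    ∀ x y, 0 < x → 0 < y → D x y = 0 := by
  have split : ∀ (m n : ℕ) (x y : ℝ), D x y *
      Real.exp (-(((m : ℝ) + 1) * x + ((n : ℝ) + 1) * y)) =
      (D x y * Real.exp (-(x + ((n : ℝ) + 1) * y))) * Real.exp (-(m * x)) := by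
    intro m n x y
    rw [mul_assoc, ← Real.exp_add]
    ring_nf
  have h1 : ∀ n : ℕ, ∀ᵐ x ∂(volume.restrict (Ioi (0 : ℝ))),
      ∫ y in Ioi (0 : ℝ), D x y * Real.exp (-(x + ((n : ℝ) + 1) * y)) = 0 := by
    intro n
    apply ae_eq_zero_of_laplace_nat
    · have := (hD 0 n).integral_prod_left
      simpa [IntegrableOn] using this
    · intro m
      refine Eq.trans ?_ (h m n)
      rw [integral_prod _ (hD m n)]
      simp only [split, integral_mul_const]
  have h2 : ∀ᵐ x ∂(volume.restrict (Ioi (0 : ℝ))), ∀ y ∈ Ioi (0 : ℝ), D x y = 0 := by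
    filter_upwards [ae_all_iff.mpr h1, (hD 0 0).prod_right_ae,
      ae_restrict_mem measurableSet_Ioi] with x hx1 hx2 hx3
    have h3 : ∀ᵐ y ∂(volume.restrict (Ioi (0 : ℝ))),
        D x y * Real.exp (-(x + y)) = 0 := by
      apply ae_eq_zero_of_laplace_nat
      · simpa [IntegrableOn] using hx2
      · intro n
        refine Eq.trans ?_ (hx1 n)
        congr 1
        ext y
        rw [mul_assoc, ← Real.exp_add]
        ring_nf
    intro y hy'
    refine eq_zero_of_ae_eq_zero le_rfl hy' (hy x hx3) (h3.mono fun z hz => ?_)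
    exact (mul_eq_zero.mp hz).resolve_right (Real.exp_pos _).ne'
  intro x y hx' hy'
  exact eq_zero_of_ae_eq_zero (G := fun x => D x y) le_rfl hx' (hx y hy')
    (h2.mono fun z hz => hz y hy')

lemma continuousOn_heatSpectral {c : ℝ} (hc : 0 < c) :
    ContinuousOn (fun p : ℝ × ℝ × ℝ => heatSpectral p.1 p.2.1 p.2.2)
      (Ioi c ×ˢ Ioi 0 ×ˢ Ioi 0) := by
  obtain ⟨M, hM, hb⟩ := psiOne_bounded
  have hm := measurable_psiOne
  unfold heatSpectral
  apply ContinuousOn.mul continuousOn_const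
  apply continuousOn_of_dominated (bound := fun l => M * M * Real.exp (-(c * l)))
  · intro p _
    apply Measurable.aestronglyMeasurable
    fun_prop
  · intro p hp
    have h1 : c < p.1 := hp.1
    rw [ae_restrict_iff' measurableSet_Ioi]
    filter_upwards with l hl
    have hl : 0 < l := hl
    rw [norm_mul, norm_mul, Real.norm_of_nonneg (Real.exp_pos _).le]
    gcongr
    · exact hb _
    · exact hb _
    · nlinarith
  · exact (integrableOn_exp_neg_mul hc).const_mul _
  · rw [ae_restrict_iff' measurableSet_Ioi]
    filter_upwards with l hl
    have hl : 0 < l := hl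
    refine (ContinuousOn.mul ?_ ?_).mul (by fun_prop)
    · exact continuousOn_psiOne.comp (by fun_prop) fun p hp => mul_pos hl hp.2.1
    · exact continuousOn_psiOne.comp (by fun_prop) fun p hp => mul_pos hl hp.2.2

lemma continuousOn_heatFree : ContinuousOn (fun p : ℝ × ℝ × ℝ => heatFree p.1 p.2.1 p.2.2)
    (Ioi 0 ×ˢ Ioi 0 ×ˢ Ioi 0) := by
  unfold heatFree
  refine ContinuousOn.mul continuousOn_const (ContinuousOn.div (by fun_prop) (by fun_prop) ?_)
  intro p hp
  have h1 : 0 < p.1 := hp.1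
  positivity

lemma exitKer_bounded : ∃ B : ℝ, ∀ u v, 0 < u → 0 < v → |exitKer u v| ≤ B := by
  obtain ⟨c, C, hc, hC, hκ⟩ := exp_etaF_bounds
  have hsq : ∀ u : ℝ, 0 < u → √(1 + u) ≤ 1 + u := fun u hu => by
    rw [Real.sqrt_le_left (by positivity)]
    nlinarith
  have hf : ∀ u, 0 < u → fexit u ≤ C * (u * (1 + u) / (1 + u ^ 2)) := by
    intro u hu
    have h1 : 1 / π ≤ 1 := by
      rw [div_le_one Real.pi_pos]; linarith [Real.pi_gt_three]
    calc fexit u ≤ 1 * (u / (1 + u ^ 2)) * (C * (1 + u)) := by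
          unfold fexit
          gcongr
          exact (hκ u hu).2.trans (by gcongr; exact hsq u hu)
      _ = _ := by ring
  have hf1 : ∀ u, 0 < u → fexit u ≤ 2 * C * u := by
    intro u hu
    refine (hf u hu).trans ?_
    have : u * (1 + u) / (1 + u ^ 2) ≤ 2 * u := by
      rw [div_le_iff₀ (by positivity)]
      nlinarith [mul_nonneg hu.le (sq_nonneg (u - 1)), pow_pos hu 3]
    nlinarith
  have hf2 : ∀ u, 0 < u → fexit u ≤ 2 * C := by
    intro u hu
    refine (hf u hu).trans ?_
    have : u * (1 + u) / (1 + u ^ 2) ≤ 2 := by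
      rw [div_le_iff₀ (by positivity)]
      nlinarith [sq_nonneg (u - 1)]
    nlinarith
  refine ⟨2 * C * (2 * C), fun u v hu hv => ?_⟩
  rw [abs_of_nonneg (exitKer_nonneg hu.le hv.le), exitKer, div_le_iff₀ (by positivity)]
  calc fexit u * fexit v ≤ (2 * C * u) * (2 * C) :=
        mul_le_mul (hf1 u hu) (hf2 v hv) (fexit_nonneg hv.le) (by positivity)
    _ = 2 * C * (2 * C) * u := by ring
    _ ≤ 2 * C * (2 * C) * (u + v) := by gcongr; linarith

lemma heatExit_eq_unit_interval {t : ℝ} (ht : 0 < t) (x y : ℝ) :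
    heatExit t x y = (t / (x * y)) *
      ∫ r in Ioo (0 : ℝ) 1, exitKer (t * r / x) (t * (1 - r) / y) := by
  have h := intervalIntegral.mul_integral_comp_mul_left (a := 0) (b := 1) (c := t)
    (f := fun s => exitKer (s / x) ((t - s) / y))
  rw [mul_zero, mul_one, intervalIntegral.integral_of_le zero_le_one,
    intervalIntegral.integral_of_le ht.le, integral_Ioc_eq_integral_Ioo (x := 0) (y := 1)] at h
  rw [heatExit, ← h]
  have h2 : ∀ r, t - t * r = t * (1 - r) := fun r => by ring
  simp only [h2]
  ring

lemma continuousOn_heatExit : ContinuousOn (fun p : ℝ × ℝ × ℝ => heatExit p.1 p.2.1 p.2.2)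
    (Ioi 0 ×ˢ Ioi 0 ×ˢ Ioi 0) := by
  obtain ⟨B, hB⟩ := exitKer_bounded
  have hm : Measurable fun p : ℝ × ℝ => exitKer p.1 p.2 := measurable_exitKer
  have hf := continuous_fexit
  have h : ContinuousOn (fun p : ℝ × ℝ × ℝ => (p.1 / (p.2.1 * p.2.2)) *
      ∫ r in Ioo (0 : ℝ) 1, exitKer (p.1 * r / p.2.1) (p.1 * (1 - r) / p.2.2))
      (Ioi 0 ×ˢ Ioi 0 ×ˢ Ioi 0) := by
    apply ContinuousOn.mul
    · refine ContinuousOn.div (by fun_prop) (by fun_prop) fun p hp => ?_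
      exact (mul_pos hp.2.1 hp.2.2).ne'
    apply continuousOn_of_dominated (bound := fun _ => B)
    · intro p _
      apply Measurable.aestronglyMeasurable
      exact hm.comp (f := fun r : ℝ => (p.1 * r / p.2.1, p.1 * (1 - r) / p.2.2)) (by fun_prop)
    · intro p hp
      rw [ae_restrict_iff' measurableSet_Ioo]
      filter_upwards with r hr
      exact hB _ _ (div_pos (mul_pos hp.1 hr.1) hp.2.1)
        (div_pos (mul_pos hp.1 (sub_pos.mpr hr.2)) hp.2.2)
    · simp
    · rw [ae_restrict_iff' measurableSet_Ioo]
      filter_upwards with r hr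
      unfold exitKer
      have hx : ∀ p ∈ Ioi (0 : ℝ) ×ˢ Ioi (0 : ℝ) ×ˢ Ioi (0 : ℝ), p.2.1 ≠ 0 :=
        fun p hp => (show 0 < p.2.1 from hp.2.1).ne'
      have hy : ∀ p ∈ Ioi (0 : ℝ) ×ˢ Ioi (0 : ℝ) ×ˢ Ioi (0 : ℝ), p.2.2 ≠ 0 :=
        fun p hp => (show 0 < p.2.2 from hp.2.2).ne'
      have c1 : ContinuousOn (fun p : ℝ × ℝ × ℝ => p.1 * r / p.2.1)
        (Ioi 0 ×ˢ Ioi 0 ×ˢ Ioi 0) := ContinuousOn.div (by fun_prop) (by fun_prop) hx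
      have c2 : ContinuousOn (fun p : ℝ × ℝ × ℝ => p.1 * (1 - r) / p.2.2)
        (Ioi 0 ×ˢ Ioi 0 ×ˢ Ioi 0) := ContinuousOn.div (by fun_prop) (by fun_prop) hy
      refine ContinuousOn.div ((hf.comp_continuousOn c1).mul (hf.comp_continuousOn c2))
        (c1.add c2) fun p hp => ?_
      exact (add_pos (div_pos (mul_pos hp.1 hr.1) hp.2.1)
        (div_pos (mul_pos hp.1 (sub_pos.mpr hr.2)) hp.2.2)).ne'
  exact h.congr fun p hp => heatExit_eq_unit_interval hp.1 _ _

/-- The difference of the two sides of the heat kernel identity. -/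
noncomputable def heatDefect (t x y : ℝ) : ℝ :=
  heatSpectral t x y - (heatFree t x y - heatExit t x y)

lemma continuousOn_heatDefect {c : ℝ} (hc : 0 < c) :
    ContinuousOn (fun p : ℝ × ℝ × ℝ => heatDefect p.1 p.2.1 p.2.2)
      (Ioi c ×ˢ Ioi 0 ×ˢ Ioi 0) := by
  have hs : Ioi c ×ˢ Ioi (0 : ℝ) ×ˢ Ioi (0 : ℝ) ⊆ Ioi 0 ×ˢ Ioi 0 ×ˢ Ioi 0 :=
    prod_mono (Ioi_subset_Ioi hc.le) le_rfl
  exact (continuousOn_heatSpectral hc).sub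
    ((continuousOn_heatFree.mono hs).sub (continuousOn_heatExit.mono hs))

lemma ae_heatDefect_eq_zero : ∀ᵐ t ∂(volume.restrict (Ioi (0 : ℝ))),
    ∀ x y, 0 < x → 0 < y → heatDefect t x y = 0 := by
  set ν := (volume.restrict (Ioi (0 : ℝ))).prod (volume.restrict (Ioi (0 : ℝ))) with hν
  have hpos : ∀ n : ℕ, (0 : ℝ) < (n : ℝ) + 1 := fun n => by positivity
  set W : ℕ → ℕ → ℝ × ℝ → ℝ := fun m n p =>
    Real.exp (-(((m : ℝ) + 1) * p.1 + ((n : ℝ) + 1) * p.2)) with hW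
  have hfe : ∀ (k m n : ℕ), Integrable (fun p : ℝ × ℝ × ℝ =>
      (heatFree p.1 p.2.1 p.2.2 - heatExit p.1 p.2.1 p.2.2) * W m n p.2 *
        Real.exp (-(((k : ℝ) + 1) * p.1))) ((volume.restrict (Ioi 0)).prod ν) ∧ _ :=
    fun k m n => integrable_heatFree_sub_heatExit (hpos m) (hpos n) (hpos k)
  have hslice : ∀ m n : ℕ, ∀ᵐ t ∂(volume.restrict (Ioi (0 : ℝ))),
      Integrable (fun p : ℝ × ℝ => (heatFree t p.1 p.2 - heatExit t p.1 p.2) * W m n p) ν := by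
    intro m n
    filter_upwards [(hfe 0 m n).1.prod_right_ae] with t ht
    have := ht.mul_const (Real.exp (((0 : ℕ) + 1) * t))
    refine this.congr (Filter.Eventually.of_forall fun p => ?_)
    simp only
    rw [mul_assoc, ← Real.exp_add, neg_add_cancel, Real.exp_zero, mul_one]
  have hspec : ∀ (m n : ℕ) (t : ℝ), 0 < t →
      Integrable (fun p : ℝ × ℝ => heatSpectral t p.1 p.2 * W m n p) ν :=
    fun m n t ht => integrable_heatSpectral ht (hpos m) (hpos n)
  have hsplit : ∀ (m n : ℕ) (t : ℝ) (p : ℝ × ℝ), heatDefect t p.1 p.2 * W m n p =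
      heatSpectral t p.1 p.2 * W m n p - (heatFree t p.1 p.2 - heatExit t p.1 p.2) * W m n p := by
    intro m n t p
    rw [heatDefect]; ring
  have h_int : ∀ m n : ℕ, ∀ᵐ t ∂(volume.restrict (Ioi (0 : ℝ))),
      Integrable (fun p : ℝ × ℝ => heatDefect t p.1 p.2 * W m n p) ν := by
    intro m n
    filter_upwards [hslice m n, ae_restrict_mem measurableSet_Ioi] with t h1 h2
    simp only [hsplit]
    exact (hspec m n t h2).sub h1
  have hlt : ∀ k m n : ℕ, IntegrableOn (fun t => (∫ p, heatDefect t p.1 p.2 * W m n p ∂ν) *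
      Real.exp (-(((k : ℝ) + 1) * t))) (Ioi 0) ∧
      ∫ t in Ioi (0 : ℝ), (∫ p, heatDefect t p.1 p.2 * W m n p ∂ν) *
        Real.exp (-(((k : ℝ) + 1) * t)) = 0 := by
    intro k m n
    obtain ⟨i1, e1⟩ := laplace_time_psiLaplace (hpos m) (hpos n) (hpos k)
    obtain ⟨i2, e2⟩ := hfe k m n
    have i3 := i2.integral_prod_left
    rw [integral_prod _ i2] at e2
    simp only [integral_mul_const] at i3 e2
    have hae : ∀ᵐ t ∂(volume.restrict (Ioi (0 : ℝ))),
        (((2 / π) * ∫ l in Ioi (0 : ℝ), psiLaplace ((m : ℝ) + 1) l *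
          psiLaplace ((n : ℝ) + 1) l * Real.exp (-(t * l))) * Real.exp (-(((k : ℝ) + 1) * t)) -
        (∫ p, (heatFree t p.1 p.2 - heatExit t p.1 p.2) * W m n p ∂ν) *
          Real.exp (-(((k : ℝ) + 1) * t))) =
        (∫ p, heatDefect t p.1 p.2 * W m n p ∂ν) * Real.exp (-(((k : ℝ) + 1) * t)) := by
      filter_upwards [hslice m n, ae_restrict_mem measurableSet_Ioi] with t h1 h2
      have h3 : ∫ p, heatSpectral t p.1 p.2 * W m n p ∂ν = _ :=
        laplace_heatSpectral h2 (hpos m) (hpos n)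
      simp only [hsplit]
      rw [integral_sub (hspec m n t h2) h1, h3, sub_mul]
    refine ⟨(i1.sub i3).congr hae, ?_⟩
    rw [← integral_congr_ae hae, integral_sub i1 i3, e1, e2, sub_self]
  have hzero : ∀ m n : ℕ, ∀ᵐ t ∂(volume.restrict (Ioi (0 : ℝ))),
      ∫ p, heatDefect t p.1 p.2 * W m n p ∂ν = 0 := by
    intro m n
    have h1 := ae_eq_zero_of_laplace_nat (hlt 0 m n).1 (fun k => by
      refine Eq.trans ?_ (hlt k m n).2
      congr 1
      ext t
      rw [mul_assoc, ← Real.exp_add]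
      push_cast
      ring_nf)
    filter_upwards [h1] with t ht
    exact (mul_eq_zero.mp ht).resolve_right (Real.exp_pos _).ne'
  filter_upwards [ae_all_iff.mpr fun m => ae_all_iff.mpr (h_int m),
    ae_all_iff.mpr fun m => ae_all_iff.mpr (hzero m), ae_restrict_mem measurableSet_Ioi]
    with t h1 h2 ht
  have ht : 0 < t := ht
  have hc := continuousOn_heatDefect (half_pos ht)
  have ht2 : t / 2 < t := half_lt_self ht
  refine eq_zero_of_laplace_nat_two (D := heatDefect t) (fun y hy => ?_) (fun x hx => ?_) h1 h2
  · exact hc.comp (f := fun x => (t, x, y)) (by fun_prop) fun x hx => ⟨ht2, hx, hy⟩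
  · exact hc.comp (f := fun y => (t, x, y)) (by fun_prop) fun y hy => ⟨ht2, hx, hy⟩

lemma heatDefect_eq_zero {t x y : ℝ} (ht : 0 < t) (hx : 0 < x) (hy : 0 < y) :
    heatDefect t x y = 0 := by
  refine eq_zero_of_ae_eq_zero (G := fun t => heatDefect t x y) (half_pos ht).le
    (half_lt_self ht) ?_ (ae_heatDefect_eq_zero.mono fun s hs => hs x y hx hy)
  exact (continuousOn_heatDefect (half_pos ht)).comp (f := fun s => (s, x, y)) (by fun_prop)
    fun s hs => ⟨hs, hx, hy⟩

theorem heat_kernel_half_line (t x y : ℝ) (ht : 0 < t) (hx : 0 < x) (hy : 0 < y) :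
    (2 / Real.pi) * (∫ l in Ioi (0 : ℝ), psiOne (l * x) * psiOne (l * y) * Real.exp (-l * t))
      = (1 / Real.pi) * (t / (t ^ 2 + (x - y) ^ 2))
        - (1 / (x * y)) * ∫ s in (0 : ℝ)..t,
            fexit (s / x) * fexit ((t - s) / y) / (s / x + (t - s) / y) := by
  rw [intervalIntegral.integral_of_le ht.le]
  exact sub_eq_zero.mp (heatDefect_eq_zero ht hx hy)
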